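/- The weighted Heisenberg group (ℍⁿ,σ) satisfies property C at every point. Concretely: for every bounded open set B ⊂ ℂⁿ × ℝ, every sequence (f_k)_{k∈ℕ} of functions in C_c^∞(B) whose CR energy is uniformly bounded, i.e., ∫ |f_k|² dσ + Σ_{j=1}^n ∫ |L̄_j f_k|² dσ ≤ 1 for all k, admits a subsequence (f_{k_m}) such that the restrictions to B of (1 − S_n) f_{k_m} converge in L²(B,σ). -/

import Mathlib

open MeasureTheory Complex Filter Topology
open scoped ContDiff ENNReal

noncomputable section

abbrev Hgrp (n : ℕ) := (Fin n → ℂ) × ℝ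

def nsq {n : ℕ} (z : Fin n → ℂ) : ℝ := ∑ j, Complex.normSq (z j)

def dZ {n : ℕ} (j : Fin n) (f : Hgrp n → ℂ) : Hgrp n → ℂ := fun p =>
  (1/2 : ℂ) * (fderiv ℝ f p (Pi.single j 1, 0) - Complex.I * fderiv ℝ f p (Pi.single j Complex.I, 0))

def dZbar {n : ℕ} (j : Fin n) (f : Hgrp n → ℂ) : Hgrp n → ℂ := fun p =>
  (1/2 : ℂ) * (fderiv ℝ f p (Pi.single j 1, 0) + Complex.I * fderiv ℝ f p (Pi.single j Complex.I, 0))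

def dT {n : ℕ} (f : Hgrp n → ℂ) : Hgrp n → ℂ := fun p => fderiv ℝ f p (0, 1)

def Lop {n : ℕ} (j : Fin n) (f : Hgrp n → ℂ) : Hgrp n → ℂ := fun p =>
  dZ j f p + Complex.I * (starRingEnd ℂ) (p.1 j) * dT f p

def Lbar {n : ℕ} (j : Fin n) (f : Hgrp n → ℂ) : Hgrp n → ℂ := fun p =>
  dZbar j f p - Complex.I * (p.1 j) * dT f p

/-- `f` is CR in the sense of distributions. -/
def IsCRfun {n : ℕ} (f : Hgrp n → ℂ) : Prop :=
  ∀ j : Fin n, ∀ φ : Hgrp n → ℂ, ContDiff ℝ ∞ φ → HasCompactSupport φ →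
    ∫ p : Hgrp n, f p * Lbar j φ p = 0

def pFourier {n : ℕ} (f : Hgrp n → ℂ) (z : Fin n → ℂ) (ξ : ℝ) : ℂ :=
  (Real.sqrt (2 * Real.pi))⁻¹ • ∫ t : ℝ, f (z, t) * Complex.exp (-Complex.I * ξ * t)

theorem eLpNorm_two_sq {X : Type*} [MeasurableSpace X] (μ : Measure X) (h : X → ℂ) :
    eLpNorm h 2 μ ^ 2 = ∫⁻ x, ‖h x‖ₑ ^ 2 ∂μ := by
  rw [eLpNorm_eq_lintegral_rpow_enorm_toReal (by norm_num) (by norm_num),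
    ← ENNReal.rpow_natCast, ← ENNReal.rpow_mul]
  simp

open FourierTransform SchwartzMap in
/-- The `L²` Fourier transform of an integrable square-integrable function is given by the
Fourier integral. -/
theorem fourier_toLp_ae_eq {h : ℝ → ℂ} (h1 : Integrable h) (h2 : MemLp h 2) :
    (𝓕 (h2.toLp h) : Lp ℂ 2 (volume : Measure ℝ)) =ᵐ[volume] 𝓕 h := by
  have hcont : Continuous (𝓕 h) :=
    VectorFourier.fourierIntegral_continuous Real.continuous_fourierChar
      continuous_inner h1
  have hloc : LocallyIntegrable (𝓕 (h2.toLp h) : Lp ℂ 2 (volume : Measure ℝ)) volume :=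
    (Lp.memLp _).locallyIntegrable (by norm_num)
  refine ae_eq_of_integral_contDiff_smul_eq hloc hcont.locallyIntegrable ?_
  intro g hg hgs
  have hgc : HasCompactSupport (fun x => (g x : ℂ)) := hgs.comp_left Complex.ofReal_zero
  have hgd : ContDiff ℝ ∞ (fun x => (g x : ℂ)) := Complex.ofRealCLM.contDiff.comp hg
  let G : 𝓢(ℝ, ℂ) := hgc.toSchwartzMap hgd
  have e1 := DFunLike.congr_fun (Lp.fourier_toTemperedDistribution_eq (h2.toLp h)) G
  rw [TemperedDistribution.fourier_apply, Lp.toTemperedDistribution_apply,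
    Lp.toTemperedDistribution_apply] at e1
  have e2 : ∫ x, g x • (𝓕 (h2.toLp h) : Lp ℂ 2 (volume : Measure ℝ)) x =
      ∫ x, G x • (𝓕 (h2.toLp h) : Lp ℂ 2 (volume : Measure ℝ)) x := by
    refine integral_congr_ae (.of_forall fun x => ?_)
    simp [G]
  rw [e2, ← e1]
  have e3 : ∫ x, (𝓕 G) x • (h2.toLp h) x = ∫ x, (𝓕 G) x • h x := by
    refine integral_congr_ae ?_
    filter_upwards [h2.coeFn_toLp] with x hx
    simp only [hx]
  rw [e3]
  have e4 := VectorFourier.integral_fourierIntegral_smul_eq_flip (L := innerₗ ℝ)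
    (μ := volume) (ν := volume) (f := (G : ℝ → ℂ)) (g := h)
    Real.continuous_fourierChar continuous_inner G.integrable h1
  rw [flip_innerₗ] at e4
  have e5 : ∫ x, (𝓕 G) x • h x = ∫ x, G x • 𝓕 h x := e4
  rw [e5]
  refine integral_congr_ae (.of_forall fun x => ?_)
  simp [G]

open FourierTransform in
/-- Plancherel's theorem for integrable square-integrable functions. -/
theorem lintegral_enorm_fourier_sq {h : ℝ → ℂ} (h1 : Integrable h) (h2 : MemLp h 2) :
    ∫⁻ t, ‖𝓕 h t‖ₑ ^ 2 = ∫⁻ t, ‖h t‖ₑ ^ 2 := by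
  have key : eLpNorm (𝓕 h) 2 volume = eLpNorm h 2 volume := by
    rw [← eLpNorm_congr_ae (fourier_toLp_ae_eq h1 h2), ← eLpNorm_congr_ae h2.coeFn_toLp,
      ← Lp.enorm_def, ← Lp.enorm_def, ← ofReal_norm, ← ofReal_norm, Lp.norm_fourier_eq]
  rw [← eLpNorm_two_sq, ← eLpNorm_two_sq, key]

open FourierTransform in
theorem lintegral_enorm_fourierInv_sq {h : ℝ → ℂ} (h1 : Integrable h) (h2 : MemLp h 2) :
    ∫⁻ t, ‖𝓕⁻ h t‖ₑ ^ 2 = ∫⁻ t, ‖h t‖ₑ ^ 2 := by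
  rw [← lintegral_enorm_fourier_sq h1 h2,
    ← (Measure.measurePreserving_neg (volume : Measure ℝ)).lintegral_comp_emb
      (MeasurableEquiv.neg ℝ).measurableEmbedding]
  simp [Real.fourierInv_eq_fourier_neg]

/-- Schur's test for averages of translates. -/
theorem lintegral_sq_lintegral_translate_le {X E : Type*} [MeasurableSpace X] [MeasurableSpace E]
    [AddGroup E] [MeasurableAdd₂ E] (μ : Measure X) [SFinite μ] (ν : Measure E) [SFinite ν]
    [ν.IsAddRightInvariant] {h : E → ℝ≥0∞} (hh : Measurable h) {τ : X → E} (hτ : Measurable τ) :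
    ∫⁻ z, (∫⁻ x, h (z + τ x) ∂μ) ^ 2 ∂ν ≤ μ Set.univ ^ 2 * ∫⁻ z, h z ^ 2 ∂ν := by
  have hm : Measurable fun p : E × X => h (p.1 + τ p.2) := by fun_prop
  have cs : ∀ z, (∫⁻ x, h (z + τ x) ∂μ) ^ 2 ≤ μ Set.univ * ∫⁻ x, h (z + τ x) ^ 2 ∂μ := by
    intro z
    have hz : Measurable fun x => h (z + τ x) := hm.comp measurable_prodMk_left
    have := ENNReal.lintegral_mul_le_Lp_mul_Lq μ (p := 2) (q := 2)
      ⟨by norm_num, by norm_num, by norm_num⟩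
      (f := fun _ => 1) (g := fun x => h (z + τ x)) aemeasurable_const hz.aemeasurable
    have h2 := pow_le_pow_left₀ (zero_le) this 2
    rw [mul_pow, ← ENNReal.rpow_natCast, ← ENNReal.rpow_natCast, ← ENNReal.rpow_natCast,
      ← ENNReal.rpow_mul, ← ENNReal.rpow_mul] at h2
    simpa using h2
  calc ∫⁻ z, (∫⁻ x, h (z + τ x) ∂μ) ^ 2 ∂ν
      ≤ ∫⁻ z, μ Set.univ * ∫⁻ x, h (z + τ x) ^ 2 ∂μ ∂ν := lintegral_mono cs
    _ = μ Set.univ * ∫⁻ z, ∫⁻ x, h (z + τ x) ^ 2 ∂μ ∂ν :=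
        lintegral_const_mul _ (hm.pow_const 2).lintegral_prod_right'
    _ = μ Set.univ * ∫⁻ x, ∫⁻ z, h (z + τ x) ^ 2 ∂ν ∂μ := by
        rw [lintegral_lintegral_swap (hm.pow_const 2).aemeasurable]
    _ = μ Set.univ * ∫⁻ _, (∫⁻ z, h z ^ 2 ∂ν) ∂μ := by
        congr 1
        refine lintegral_congr fun x => ?_
        exact lintegral_add_right_eq_self (fun z => h z ^ 2) (τ x)
    _ = _ := by rw [lintegral_const]; ring

section Gaussian

variable {n : ℕ}

theorem continuous_nsq : Continuous (nsq (n := n)) := by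
  unfold nsq
  exact continuous_finsetSum _ fun j _ => Complex.continuous_normSq.comp (continuous_apply j)

theorem nsq_nonneg (y : Fin n → ℂ) : 0 ≤ nsq y :=
  Finset.sum_nonneg fun _ _ => Complex.normSq_nonneg _

theorem nsq_smul (c : ℂ) (y : Fin n → ℂ) : nsq (c • y) = ‖c‖ ^ 2 * nsq y := by
  simp [nsq, Finset.mul_sum, Complex.normSq_eq_norm_sq, mul_pow]

theorem nsq_real_smul (r : ℝ) (y : Fin n → ℂ) : nsq (r • y) = r ^ 2 * nsq y := by
  simp [nsq, Finset.mul_sum, Complex.normSq_eq_norm_sq, mul_pow]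

theorem norm_sq_le_nsq (y : Fin n → ℂ) : ‖y‖ ^ 2 ≤ nsq y := by
  have h : ‖y‖ ≤ √(nsq y) := by
    refine (pi_norm_le_iff_of_nonneg (Real.sqrt_nonneg _)).2 fun j => ?_
    refine Real.le_sqrt_of_sq_le ?_
    rw [← Complex.normSq_eq_norm_sq]
    exact Finset.single_le_sum (f := fun j => Complex.normSq (y j))
      (fun _ _ => Complex.normSq_nonneg _) (Finset.mem_univ j)
  calc ‖y‖ ^ 2 ≤ √(nsq y) ^ 2 := by gcongr
    _ = nsq y := Real.sq_sqrt (nsq_nonneg y)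

theorem integrable_gaussian {κ : ℝ} (hκ : 0 < κ) :
    Integrable fun y : Fin n → ℂ => Real.exp (-κ * nsq y) := by
  have h1 : Integrable fun w : ℂ => Real.exp (-κ * Complex.normSq w) := by
    have := (GaussianFourier.integrable_cexp_neg_mul_sq_norm_add (V := ℂ) (b := (κ : ℂ))
      (by simpa using hκ) 0 0).norm
    refine this.congr (.of_forall fun w => ?_)
    simp only [Complex.norm_exp, Complex.normSq_eq_norm_sq]
    norm_cast
    simp
  have := Integrable.fintype_prod (f := fun (_ : Fin n) (w : ℂ) => Real.exp (-κ * normSq w))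
    (μ := fun _ => volume) fun _ => h1
  refine this.congr (.of_forall fun y => ?_)
  simp only [nsq, Finset.mul_sum, Real.exp_sum]

theorem integrable_norm_mul_gaussian {κ : ℝ} (hκ : 0 < κ) :
    Integrable fun y : Fin n → ℂ => ‖y‖ * Real.exp (-κ * nsq y) := by
  refine ((integrable_gaussian (n := n) (half_pos hκ)).const_mul (1 + 1 / κ)).mono'
    (by have := continuous_nsq (n := n); fun_prop) (.of_forall fun y => ?_)
  rw [Real.norm_of_nonneg (by positivity)]
  have e : Real.exp (-κ * nsq y) = Real.exp (-(κ / 2) * nsq y) * Real.exp (-(κ / 2) * nsq y) := by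
    rw [← Real.exp_add]; ring_nf
  have h2 : ‖y‖ * Real.exp (-(κ / 2) * nsq y) ≤ 1 + 1 / κ := by
    rw [neg_mul, Real.exp_neg, ← div_eq_mul_inv, div_le_iff₀ (Real.exp_pos _)]
    have h3 : 1 + κ / 2 * ‖y‖ ^ 2 ≤ Real.exp (κ / 2 * nsq y) := by
      have := Real.add_one_le_exp (κ / 2 * nsq y)
      have := mul_le_mul_of_nonneg_left (norm_sq_le_nsq y) (half_pos hκ).le
      linarith
    have h4 : (1 + 1 / κ) * (1 + κ / 2 * ‖y‖ ^ 2)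
        = 1 + 1 / κ + κ / 2 * ‖y‖ ^ 2 + ‖y‖ ^ 2 / 2 := by
      field_simp
      ring
    have h5 : ‖y‖ ≤ (1 + 1 / κ) * (1 + κ / 2 * ‖y‖ ^ 2) := by
      rw [h4]
      have : 0 < 1 / κ := by positivity
      have : 0 ≤ κ / 2 * ‖y‖ ^ 2 := by positivity
      nlinarith [sq_nonneg (‖y‖ - 1)]
    refine h5.trans (mul_le_mul_of_nonneg_left h3 (by positivity))
  calc ‖y‖ * Real.exp (-κ * nsq y)
      = (‖y‖ * Real.exp (-(κ / 2) * nsq y)) * Real.exp (-(κ / 2) * nsq y) := by rw [e]; ring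
    _ ≤ _ := by gcongr

theorem measurePreserving_unit_smul {c : ℂ} (hc : ‖c‖ = 1) :
    MeasurePreserving (fun y : Fin n → ℂ => c • y) := by
  have h1 : MeasurePreserving (fun w : ℂ => c * w) := by
    have hc' : c ∈ Submonoid.unitSphere ℂ := by simpa [Submonoid.unitSphere] using hc
    exact (rotation ⟨c, hc'⟩).measurePreserving
  exact volume_preserving_pi (f := fun (_ : Fin n) (w : ℂ) => c * w) fun _ => h1

theorem measurableEmbedding_unit_smul {c : ℂ} (hc : ‖c‖ = 1) :
    MeasurableEmbedding (fun y : Fin n → ℂ => c • y) :=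
  measurableEmbedding_const_smul₀ (by rintro rfl; simp at hc)

/-- The Gaussian average of the angular derivative vanishes. -/
theorem integral_gaussian_angular_deriv {Φ : (Fin n → ℂ) → ℂ} (hΦ : ContDiff ℝ 1 Φ)
    (hs : HasCompactSupport Φ) {κ : ℝ} (hκ : 0 < κ) {r : ℝ} (hr : r ≠ 0) :
    ∫ y, (Real.exp (-κ * nsq y) : ℂ) * fderiv ℝ Φ (r • y) (Complex.I • y) = 0 := by
  have hn := continuous_nsq (n := n)
  have hfd : Continuous (fderiv ℝ Φ) := hΦ.continuous_fderiv one_ne_zero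
  obtain ⟨M, hM⟩ := hfd.bounded_above_of_compact_support (hs.fderiv (𝕜 := ℝ))
  obtain ⟨M', hM'⟩ := hΦ.continuous.bounded_above_of_compact_support hs
  have hce : ∀ θ : ℝ, ‖Complex.exp (θ * Complex.I)‖ = 1 := Complex.norm_exp_ofReal_mul_I
  have hder : ∀ (y : Fin n → ℂ) (θ : ℝ), HasDerivAt
      (fun θ : ℝ => (Real.exp (-κ * nsq y) : ℂ) * Φ (Complex.exp (θ * Complex.I) • r • y))
      ((Real.exp (-κ * nsq y) : ℂ) * fderiv ℝ Φ (Complex.exp (θ * Complex.I) • r • y)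
        ((Complex.exp (θ * Complex.I) * Complex.I) • r • y)) θ := by
    intro y θ
    have h1 : HasDerivAt (fun θ : ℝ => Complex.exp (θ * Complex.I))
        (Complex.exp (θ * Complex.I) * Complex.I) θ := by
      have := (((hasDerivAt_id θ).ofReal_comp).mul_const Complex.I).cexp
      simpa using this
    have h2 := h1.smul_const (r • y)
    exact (((hΦ.differentiable one_ne_zero _).hasFDerivAt).comp_hasDerivAt θ h2).const_mul _
  have hmain := (hasDerivAt_integral_of_dominated_loc_of_deriv_le (μ := volume) (x₀ := (0 : ℝ))
    (s := Set.univ) (bound := fun y : Fin n → ℂ => M * |r| * (‖y‖ * Real.exp (-κ * nsq y)))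
    (F := fun (θ : ℝ) (y : Fin n → ℂ) =>
      (Real.exp (-κ * nsq y) : ℂ) * Φ (Complex.exp (θ * Complex.I) • r • y))
    (F' := fun (θ : ℝ) (y : Fin n → ℂ) =>
      (Real.exp (-κ * nsq y) : ℂ) * fderiv ℝ Φ (Complex.exp (θ * Complex.I) • r • y)
        ((Complex.exp (θ * Complex.I) * Complex.I) • r • y))
    Filter.univ_mem (.of_forall fun θ => ?_) ?_ ?_ (.of_forall fun y θ _ => ?_)
    ((integrable_norm_mul_gaussian hκ).const_mul _)
    (.of_forall fun y θ _ => hder y θ)).2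
  · have hconst : (fun θ : ℝ => ∫ y : Fin n → ℂ,
        (Real.exp (-κ * nsq y) : ℂ) * Φ (Complex.exp (θ * Complex.I) • r • y)) =
        fun _ => ∫ y : Fin n → ℂ, (Real.exp (-κ * nsq y) : ℂ) * Φ (r • y) := by
      funext θ
      rw [← (measurePreserving_unit_smul (n := n) (hce θ)).integral_comp
        (measurableEmbedding_unit_smul (hce θ))
        (fun y => (Real.exp (-κ * nsq y) : ℂ) * Φ (r • y))]
      refine integral_congr_ae (.of_forall fun y => ?_)
      simp only [nsq_smul, hce]
      rw [smul_comm]; simp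
    rw [hconst] at hmain
    have h0 := hmain.unique (hasDerivAt_const _ _)
    have h1 : ∫ y : Fin n → ℂ, (r : ℂ) * ((Real.exp (-κ * nsq y) : ℂ) *
        fderiv ℝ Φ (r • y) (Complex.I • y)) = 0 := by
      rw [← h0]
      refine integral_congr_ae (.of_forall fun y => ?_)
      have : Complex.I • r • y = r • Complex.I • y := smul_comm _ _ _
      simp [this]
      ring
    rw [integral_const_mul] at h1
    exact (mul_eq_zero.1 h1).resolve_left (by exact_mod_cast hr)
  · exact Continuous.aestronglyMeasurable
      (by have := hΦ.continuous; fun_prop)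
  · refine ((integrable_gaussian (n := n) hκ).mul_const M').mono'
      (Continuous.aestronglyMeasurable (by have := hΦ.continuous; fun_prop))
      (.of_forall fun y => ?_)
    rw [norm_mul, Complex.norm_real, Real.norm_of_nonneg (Real.exp_pos _).le]
    gcongr
    exact hM' _
  · exact Continuous.aestronglyMeasurable (by fun_prop)
  · rw [norm_mul, Complex.norm_real, Real.norm_of_nonneg (Real.exp_pos _).le]
    have h1 := (fderiv ℝ Φ (Complex.exp (θ * Complex.I) • r • y)).le_of_opNorm_le (hM _)
      ((Complex.exp (θ * Complex.I) * Complex.I) • r • y)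
    rw [norm_smul, norm_mul, hce, norm_smul] at h1
    simp only [Complex.norm_I, one_mul, Real.norm_eq_abs, mul_one] at h1
    calc _ ≤ Real.exp (-κ * nsq y) * (M * (|r| * ‖y‖)) := by gcongr
      _ = _ := by ring

/-- The difference between a value and a Gaussian average only involves the
antiholomorphic part of the derivative. -/
theorem gaussian_mean_value {Φ : (Fin n → ℂ) → ℂ} (hΦ : ContDiff ℝ 1 Φ)
    (hs : HasCompactSupport Φ) {κ : ℝ} (hκ : 0 < κ) :
    (∫ y : Fin n → ℂ, (Real.exp (-κ * nsq y) : ℂ) * Φ y) -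
        (∫ y : Fin n → ℂ, (Real.exp (-κ * nsq y) : ℂ)) * Φ 0 =
      ∫ p : ℝ × (Fin n → ℂ), (Real.exp (-κ * nsq p.2) : ℂ) *
        (fderiv ℝ Φ (p.1 • p.2) p.2 + Complex.I * fderiv ℝ Φ (p.1 • p.2) (Complex.I • p.2))
        ∂((volume.restrict (Set.Ioc 0 1)).prod volume) := by
  have hn := continuous_nsq (n := n)
  have hfd : Continuous (fderiv ℝ Φ) := hΦ.continuous_fderiv one_ne_zero
  obtain ⟨M, hM⟩ := hfd.bounded_above_of_compact_support (hs.fderiv (𝕜 := ℝ))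
  obtain ⟨M', hM'⟩ := hΦ.continuous.bounded_above_of_compact_support hs
  have hdom : Integrable (fun p : ℝ × (Fin n → ℂ) => M * (‖p.2‖ * Real.exp (-κ * nsq p.2)))
      ((volume.restrict (Set.Ioc (0 : ℝ) 1)).prod volume) := by
    have := (integrable_const (μ := volume.restrict (Set.Ioc (0 : ℝ) 1)) M).mul_prod
      (integrable_norm_mul_gaussian (n := n) hκ)
    exact this
  have hint : ∀ c : ℂ, ‖c‖ = 1 → Integrable (fun p : ℝ × (Fin n → ℂ) =>
      (Real.exp (-κ * nsq p.2) : ℂ) * fderiv ℝ Φ (p.1 • p.2) (c • p.2))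
      ((volume.restrict (Set.Ioc (0 : ℝ) 1)).prod volume) := by
    intro c hc
    refine hdom.mono' (Continuous.aestronglyMeasurable (by fun_prop)) (.of_forall fun p => ?_)
    rw [norm_mul, Complex.norm_real, Real.norm_of_nonneg (Real.exp_pos _).le]
    have h1 := (fderiv ℝ Φ (p.1 • p.2)).le_of_opNorm_le (hM _) (c • p.2)
    rw [norm_smul, hc, one_mul] at h1
    calc _ ≤ Real.exp (-κ * nsq p.2) * (M * ‖p.2‖) := by gcongr
      _ = _ := by ring
  have hint1 := hint 1 norm_one
  simp only [one_smul] at hint1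
  have hintI := hint Complex.I Complex.norm_I
  have hG : Integrable (fun y : Fin n → ℂ => (Real.exp (-κ * nsq y) : ℂ)) :=
    (integrable_gaussian hκ).ofReal
  have hGΦ : Integrable (fun y : Fin n → ℂ => (Real.exp (-κ * nsq y) : ℂ) * Φ y) := by
    refine ((integrable_gaussian (n := n) hκ).mul_const M').mono'
      (Continuous.aestronglyMeasurable (by have := hΦ.continuous; fun_prop))
      (.of_forall fun y => ?_)
    rw [norm_mul, Complex.norm_real, Real.norm_of_nonneg (Real.exp_pos _).le]
    gcongr
    exact hM' _
  have hftc : ∀ y : Fin n → ℂ, ∫ r in Set.Ioc (0 : ℝ) 1, fderiv ℝ Φ (r • y) y = Φ y - Φ 0 := by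
    intro y
    rw [← intervalIntegral.integral_of_le zero_le_one]
    have := intervalIntegral.integral_eq_sub_of_hasDerivAt (a := (0 : ℝ)) (b := 1)
      (f := fun r : ℝ => Φ (r • y)) (f' := fun r => fderiv ℝ Φ (r • y) y)
      (fun r _ => by
        have h2 : HasDerivAt (fun r : ℝ => r • y) y r := by
          simpa using (hasDerivAt_id r).smul_const y
        exact ((hΦ.differentiable one_ne_zero _).hasFDerivAt).comp_hasDerivAt r h2)
      (Continuous.intervalIntegrable (by fun_prop) _ _)
    simpa using this
  have hI0 : ∫ p : ℝ × (Fin n → ℂ), (Real.exp (-κ * nsq p.2) : ℂ) *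
      fderiv ℝ Φ (p.1 • p.2) (Complex.I • p.2)
      ∂((volume.restrict (Set.Ioc 0 1)).prod volume) = 0 := by
    rw [integral_prod _ hintI]
    refine setIntegral_eq_zero_of_forall_eq_zero fun r hr => ?_
    exact integral_gaussian_angular_deriv hΦ hs hκ hr.1.ne'
  have hsplit : ∀ p : ℝ × (Fin n → ℂ), (Real.exp (-κ * nsq p.2) : ℂ) *
      (fderiv ℝ Φ (p.1 • p.2) p.2 + Complex.I * fderiv ℝ Φ (p.1 • p.2) (Complex.I • p.2)) =
      (Real.exp (-κ * nsq p.2) : ℂ) * fderiv ℝ Φ (p.1 • p.2) p.2 +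
      Complex.I * ((Real.exp (-κ * nsq p.2) : ℂ) *
        fderiv ℝ Φ (p.1 • p.2) (Complex.I • p.2)) := fun p => by ring
  simp_rw [hsplit]
  rw [integral_add hint1 (hintI.const_mul _), integral_const_mul, hI0, mul_zero, add_zero,
    integral_prod_symm _ hint1, ← integral_mul_const, ← integral_sub hGΦ (hG.mul_const _)]
  refine integral_congr_ae (.of_forall fun y => ?_)
  simp only
  rw [integral_const_mul, hftc]
  ring

end Gaussian

section Slice

variable {n : ℕ}

/-- The imaginary part of the Hermitian pairing. -/
def imPair (z y : Fin n → ℂ) : ℝ := ∑ j, ((starRingEnd ℂ) (z j) * y j).im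

/-- The factor relating translates of `exp (-ξ |z|²)`-twisted functions to untwisted ones. -/
def twist (ξ : ℝ) (z y : Fin n → ℂ) : ℂ :=
  Complex.exp (ξ * (nsq y - 2 * Complex.I * imPair z y))

/-- The twisted Cauchy–Riemann operator `∂_{z̄_j} + ξ z_j`. -/
def twistedDbar (ξ : ℝ) (j : Fin n) (F : (Fin n → ℂ) → ℂ) (z : Fin n → ℂ) : ℂ :=
  (1 / 2 : ℂ) * (fderiv ℝ F z (Pi.single j 1) + Complex.I * fderiv ℝ F z (Pi.single j Complex.I))
    + ξ * z j * F z

/-- The twisted average of `F` against the normalized Gaussian of concentration `κ`. -/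
def gaussAvg (ξ κ : ℝ) (F : (Fin n → ℂ) → ℂ) (z : Fin n → ℂ) : ℂ :=
  ((∫ y : Fin n → ℂ, Real.exp (-κ * nsq y) : ℝ) : ℂ)⁻¹ *
    ∫ y, (Real.exp (-κ * nsq y) : ℂ) * (twist ξ z y * F (z + y))

theorem imPair_add_smul (z y v : Fin n → ℂ) (s : ℝ) :
    imPair z (y + s • v) = imPair z y + s * imPair z v := by
  simp only [imPair, Finset.mul_sum, ← Finset.sum_add_distrib]
  refine Finset.sum_congr rfl fun j _ => ?_
  simp
  ring

theorem nsq_add_smul (y v : Fin n → ℂ) (s : ℝ) :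
    nsq (y + s • v) = nsq y + s * (2 * ∑ j, ((starRingEnd ℂ) (y j) * v j).re) + s ^ 2 * nsq v := by
  simp only [nsq, Finset.mul_sum, ← Finset.sum_add_distrib]
  refine Finset.sum_congr rfl fun j _ => ?_
  simp [Complex.normSq_apply]
  ring

theorem contDiff_nsq : ContDiff ℝ ∞ (nsq (n := n)) := by
  unfold nsq
  refine ContDiff.sum fun j _ => ?_
  simp only [Complex.normSq_apply]
  have h1 : ContDiff ℝ ∞ fun y : Fin n → ℂ => (y j).re :=
    Complex.reCLM.contDiff.comp (contDiff_apply ℝ ℂ j)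
  have h2 : ContDiff ℝ ∞ fun y : Fin n → ℂ => (y j).im :=
    Complex.imCLM.contDiff.comp (contDiff_apply ℝ ℂ j)
  fun_prop

theorem contDiff_imPair : ContDiff ℝ ∞ fun p : (Fin n → ℂ) × (Fin n → ℂ) => imPair p.1 p.2 := by
  unfold imPair
  refine ContDiff.sum fun j _ => ?_
  refine Complex.imCLM.contDiff.comp (ContDiff.mul (Complex.conjCLE.contDiff.comp ?_) ?_)
  · exact (contDiff_apply ℝ ℂ j).comp contDiff_fst
  · exact (contDiff_apply ℝ ℂ j).comp contDiff_snd

theorem contDiff_twist (ξ : ℝ) :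
    ContDiff ℝ ∞ fun p : (Fin n → ℂ) × (Fin n → ℂ) => twist ξ p.1 p.2 := by
  unfold twist
  have h1 : ContDiff ℝ ∞ fun p : (Fin n → ℂ) × (Fin n → ℂ) => (nsq p.2 : ℂ) :=
    Complex.ofRealCLM.contDiff.comp (contDiff_nsq.comp contDiff_snd)
  have h2 : ContDiff ℝ ∞ fun p : (Fin n → ℂ) × (Fin n → ℂ) => (imPair p.1 p.2 : ℂ) :=
    Complex.ofRealCLM.contDiff.comp contDiff_imPair
  exact (contDiff_const.mul (h1.sub (contDiff_const.mul h2))).cexp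

theorem norm_twist (ξ : ℝ) (z y : Fin n → ℂ) : ‖twist ξ z y‖ = Real.exp (ξ * nsq y) := by
  simp [twist, Complex.norm_exp]

theorem apply_add_I_mul_apply (T : (Fin n → ℂ) →L[ℝ] ℂ) (v : Fin n → ℂ) :
    T v + Complex.I * T (Complex.I • v) = ∑ j, (starRingEnd ℂ) (v j) *
      (T (Pi.single j 1) + Complex.I * T (Pi.single j Complex.I)) := by
  have key : ∀ w : Fin n → ℂ, T w = ∑ j, (((w j).re : ℂ) * T (Pi.single j 1) +
      ((w j).im : ℂ) * T (Pi.single j Complex.I)) := by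
    intro w
    have : w = ∑ j, ((w j).re • (Pi.single j 1 : Fin n → ℂ) +
        (w j).im • (Pi.single j Complex.I : Fin n → ℂ)) := by
      ext k
      simp only [Finset.sum_apply, Pi.add_apply, Pi.smul_apply, Pi.single_apply]
      rw [Finset.sum_eq_single k (by intro b _ hb; simp [hb.symm]) (by simp)]
      simp
    conv_lhs => rw [this]
    simp
  rw [key v, key (Complex.I • v), Finset.mul_sum, ← Finset.sum_add_distrib]
  refine Finset.sum_congr rfl fun j _ => ?_
  have : (starRingEnd ℂ) (v j) = (v j).re - (v j).im * Complex.I := by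
    apply Complex.ext <;> simp
  rw [this]
  simp only [Pi.smul_apply, smul_eq_mul, Complex.mul_re, Complex.mul_im, Complex.I_re,
    Complex.I_im]
  push_cast
  linear_combination ((v j).im * T (Pi.single j Complex.I)) * Complex.I_sq

theorem dbar_twist_mul {F : (Fin n → ℂ) → ℂ} (hF : ContDiff ℝ 1 F) (ξ : ℝ)
    (z y v : Fin n → ℂ) :
    fderiv ℝ (fun y => twist ξ z y * F (z + y)) y v +
        Complex.I * fderiv ℝ (fun y => twist ξ z y * F (z + y)) y (Complex.I • v) =
      2 * ∑ j, (starRingEnd ℂ) (v j) * (twist ξ z y * twistedDbar ξ j F (z + y)) := by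
  have htw : ContDiff ℝ 1 fun y => twist ξ z y :=
    ((contDiff_twist ξ).comp (contDiff_const.prodMk contDiff_id)).of_le (by norm_cast)
  have hd : DifferentiableAt ℝ (fun y => twist ξ z y * F (z + y)) y :=
    ((htw.mul (hF.comp (contDiff_const.add contDiff_id))).differentiable one_ne_zero) y
  have hdir : ∀ v : Fin n → ℂ, fderiv ℝ (fun y => twist ξ z y * F (z + y)) y v =
      twist ξ z y * (ξ * (2 * (∑ j, ((starRingEnd ℂ) (y j) * v j).re : ℝ) -
        2 * Complex.I * imPair z v) * F (z + y) + fderiv ℝ F (z + y) v) := by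
    intro v
    have hline : HasDerivAt (fun s : ℝ => y + s • v) v 0 := by
      simpa using ((hasDerivAt_id (0 : ℝ)).smul_const v).const_add y
    have e1 : HasDerivAt (fun s : ℝ => twist ξ z (y + s • v) * F (z + (y + s • v)))
        (fderiv ℝ (fun y => twist ξ z y * F (z + y)) y v) 0 := by
      have h := hd.hasFDerivAt
      have h0 : y = y + (0 : ℝ) • v := by simp
      rw [h0] at h
      have := h.comp_hasDerivAt (0 : ℝ) hline
      simpa [Function.comp_def] using this
    have e2 : HasDerivAt (fun s : ℝ => F (z + (y + s • v))) (fderiv ℝ F (z + y) v) 0 := by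
      have h := (hF.differentiable one_ne_zero (z + (y + (0 : ℝ) • v))).hasFDerivAt
      have := h.comp_hasDerivAt (0 : ℝ) (hline.const_add z)
      simpa [Function.comp_def] using this
    have e3 : HasDerivAt (fun s : ℝ => twist ξ z (y + s • v))
        (twist ξ z y * (ξ * (2 * (∑ j, ((starRingEnd ℂ) (y j) * v j).re : ℝ) -
        2 * Complex.I * imPair z v))) 0 := by
      simp only [twist, nsq_add_smul, imPair_add_smul]
      set A : ℝ := ∑ j, ((starRingEnd ℂ) (y j) * v j).re
      have hs : HasDerivAt (fun s : ℝ => (s : ℂ)) 1 0 := by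
        simpa using (hasDerivAt_id (0 : ℝ)).ofReal_comp
      have h4 : HasDerivAt (fun s : ℝ => (ξ : ℂ) * (((nsq y : ℂ) + s * (2 * A) + s ^ 2 * nsq v) -
          2 * Complex.I * (imPair z y + s * imPair z v)))
          (ξ * (2 * A - 2 * Complex.I * imPair z v)) 0 := by
        have := ((((hs.mul_const (2 * (A : ℂ))).const_add (nsq y : ℂ)).add
          ((hs.pow 2).mul_const (nsq v : ℂ))).sub
          (((hs.mul_const (imPair z v : ℂ)).const_add (imPair z y : ℂ)).const_mul
            (2 * Complex.I))).const_mul (ξ : ℂ)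
        simpa using this
      have h5 := h4.cexp
      simpa using h5
    have e4 := e3.mul e2
    have := e1.unique e4
    rw [this]
    simp
    ring
  rw [hdir v, hdir (Complex.I • v)]
  have hA := apply_add_I_mul_apply (fderiv ℝ F (z + y)) v
  have hQ : (2 * (∑ j, ((starRingEnd ℂ) (y j) * v j).re : ℝ) - 2 * Complex.I * imPair z v : ℂ) +
      Complex.I * (2 * (∑ j, ((starRingEnd ℂ) (y j) * (Complex.I • v) j).re : ℝ) -
        2 * Complex.I * imPair z (Complex.I • v)) =
      2 * ∑ j, (starRingEnd ℂ) (v j) * (z + y) j := by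
    simp only [imPair, Complex.ofReal_sum, Finset.mul_sum, ← Finset.sum_sub_distrib,
      ← Finset.sum_add_distrib]
    refine Finset.sum_congr rfl fun j _ => ?_
    apply Complex.ext <;> simp <;> ring
  have hS : (2 : ℂ) * ∑ j, (starRingEnd ℂ) (v j) * (twist ξ z y * twistedDbar ξ j F (z + y)) =
      twist ξ z y * ((∑ j, (starRingEnd ℂ) (v j) * (fderiv ℝ F (z + y) (Pi.single j 1) +
        Complex.I * fderiv ℝ F (z + y) (Pi.single j Complex.I))) +
        ξ * (2 * ∑ j, (starRingEnd ℂ) (v j) * (z + y) j) * F (z + y)) := by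
    simp only [twistedDbar, Finset.mul_sum, Finset.sum_mul, ← Finset.sum_add_distrib]
    refine Finset.sum_congr rfl fun j _ => ?_
    ring
  rw [hS, ← hA, ← hQ]
  ring

end Slice

theorem sq_sum_le_card_mul_sum_sq_ennreal {ι : Type*} (s : Finset ι) (a : ι → ℝ≥0∞) :
    (∑ i ∈ s, a i) ^ 2 ≤ s.card * ∑ i ∈ s, a i ^ 2 := by
  have := ENNReal.rpow_sum_le_const_mul_sum_rpow s a (p := 2) (by norm_num)
  norm_num at this
  exact this

theorem add_sq_le_ennreal (a b : ℝ≥0∞) : (a + b) ^ 2 ≤ 2 * (a ^ 2 + b ^ 2) := by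
  simpa using sq_sum_le_card_mul_sum_sq_ennreal Finset.univ ![a, b]

theorem le_four_mul_of_le {a b : ℝ≥0∞} (ha : a ≠ ⊤) (h : a ≤ 2 * (b + 4⁻¹ * a)) : a ≤ 4 * b := by
  rcases eq_or_ne b ⊤ with rfl | hb
  · simp
  lift a to NNReal using ha
  lift b to NNReal using hb
  have e4 : (4 : ℝ≥0∞)⁻¹ = ((4⁻¹ : NNReal) : ℝ≥0∞) := by simp
  rw [e4] at h
  norm_cast at h ⊢
  rw [← NNReal.coe_le_coe] at h ⊢
  push_cast at h ⊢
  linarith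

section SliceBounds

variable {n : ℕ}

/-- The total mass of the Gaussian `exp (-κ |y|²)` on `ℂⁿ`. -/
def gaussMass (n : ℕ) (κ : ℝ) : ℝ := ∫ y : Fin n → ℂ, Real.exp (-κ * nsq y)

/-- The first absolute moment of the Gaussian `exp (-κ |y|²)` on `ℂⁿ`. -/
def gaussMoment (n : ℕ) (κ : ℝ) : ℝ := ∫ y : Fin n → ℂ, ‖y‖ * Real.exp (-κ * nsq y)

theorem gaussMass_pos {κ : ℝ} (hκ : 0 < κ) : 0 < gaussMass n κ := by
  refine integral_exp_pos ?_
  exact integrable_gaussian hκ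

theorem gaussMoment_nonneg (κ : ℝ) : 0 ≤ gaussMoment n κ :=
  integral_nonneg fun _ => by positivity

theorem integral_comp_sqrt_smul (g : (Fin n → ℂ) → ℝ) {κ : ℝ} (hκ : 0 < κ) :
    ∫ y, g (√κ • y) = (κ ^ n)⁻¹ * ∫ y, g y := by
  rw [Measure.integral_comp_smul]
  have : Module.finrank ℝ (Fin n → ℂ) = 2 * n := by
    rw [Module.finrank_pi_fintype]; simp [Complex.finrank_real_complex, mul_comm]
  rw [this, pow_mul, Real.sq_sqrt hκ.le, abs_of_pos (by positivity), smul_eq_mul]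

theorem gaussMass_eq {κ : ℝ} (hκ : 0 < κ) : gaussMass n κ = (κ ^ n)⁻¹ * gaussMass n 1 := by
  rw [gaussMass, gaussMass, ← integral_comp_sqrt_smul _ hκ]
  simp [nsq_real_smul, Real.sq_sqrt hκ.le]

theorem gaussMoment_eq {κ : ℝ} (hκ : 0 < κ) :
    gaussMoment n κ = (√κ)⁻¹ * ((κ ^ n)⁻¹ * gaussMoment n 1) := by
  rw [gaussMoment, gaussMoment, ← integral_comp_sqrt_smul _ hκ, ← integral_const_mul]
  refine integral_congr_ae (.of_forall fun y => ?_)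
  have : 0 < √κ := Real.sqrt_pos.2 hκ
  simp only [nsq_real_smul, Real.sq_sqrt hκ.le, norm_smul, Real.norm_eq_abs, abs_of_pos this]
  field_simp

/-- The constant in the slice estimate. -/
def sliceConst (n : ℕ) : ℝ := 8 * 4 ^ n * (gaussMoment n 1 / gaussMass n 1) ^ 2

theorem sliceConst_nonneg : 0 ≤ sliceConst n := by unfold sliceConst; positivity

theorem sq_gaussMoment_div {κ : ℝ} (hκ : 0 < κ) :
    (2 * gaussMoment n (κ / 2) / gaussMass n κ) ^ 2 = sliceConst n / κ := by
  have h1 := gaussMass_pos (n := n) one_pos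
  rw [gaussMass_eq hκ, gaussMoment_eq (half_pos hκ), sliceConst]
  have h2 : √(κ / 2) ^ 2 = κ / 2 := Real.sq_sqrt (by positivity)
  have h3 : 0 < √(κ / 2) := Real.sqrt_pos.2 (by positivity)
  have h4 : (4 : ℝ) ^ n = 2 ^ n * 2 ^ n := by rw [← mul_pow]; norm_num
  rw [div_pow, mul_pow, mul_pow, inv_pow, h2, h4, div_pow κ 2 n]
  field_simp
  ring

theorem norm_eval_le_norm (w : Fin n → ℂ) (j : Fin n) : ‖w j‖ ≤ ‖w‖ := norm_le_pi_norm w j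

theorem continuous_twistedDbar {F : (Fin n → ℂ) → ℂ} (hF : ContDiff ℝ 1 F) (ξ : ℝ) (j : Fin n) :
    Continuous (twistedDbar ξ j F) := by
  have h1 : Continuous (fderiv ℝ F) := hF.continuous_fderiv one_ne_zero
  have h2 := hF.continuous
  unfold twistedDbar
  fun_prop

theorem contDiff_twist_mul {F : (Fin n → ℂ) → ℂ} (hF : ContDiff ℝ 1 F) (ξ : ℝ) (z : Fin n → ℂ) :
    ContDiff ℝ 1 fun y => twist ξ z y * F (z + y) :=
  (((contDiff_twist ξ).comp (contDiff_const.prodMk contDiff_id)).of_le (by norm_cast)).mul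
    (hF.comp (contDiff_const.add contDiff_id))

theorem hasCompactSupport_twist_mul {F : (Fin n → ℂ) → ℂ} (hF : HasCompactSupport F) (ξ : ℝ)
    (z : Fin n → ℂ) : HasCompactSupport fun y => twist ξ z y * F (z + y) :=
  (hF.comp_homeomorph (Homeomorph.addLeft z)).mul_left

/-- The measure on `[0,1] × ℂⁿ` that dominates the error of a Gaussian average. -/
def sliceMeasure (n : ℕ) (κ : ℝ) : Measure (ℝ × (Fin n → ℂ)) :=
  ((volume.restrict (Set.Ioc (0 : ℝ) 1)).prod volume).withDensity fun p =>
    ENNReal.ofReal (2 * (‖p.2‖ * Real.exp (-(κ / 2) * nsq p.2)) / gaussMass n κ)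

theorem measurable_sliceDensity (κ : ℝ) : Measurable fun p : ℝ × (Fin n → ℂ) =>
    ENNReal.ofReal (2 * (‖p.2‖ * Real.exp (-(κ / 2) * nsq p.2)) / gaussMass n κ) := by
  have := (continuous_nsq (n := n)).measurable
  fun_prop

theorem sliceMeasure_univ {κ : ℝ} (hκ : 0 < κ) :
    sliceMeasure n κ Set.univ = ENNReal.ofReal (2 * gaussMoment n (κ / 2) / gaussMass n κ) := by
  have hG := gaussMass_pos (n := n) hκ
  rw [sliceMeasure, withDensity_apply _ MeasurableSet.univ, setLIntegral_univ,
    lintegral_prod _ (measurable_sliceDensity κ).aemeasurable]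
  simp only [lintegral_const, Measure.restrict_apply MeasurableSet.univ, Set.univ_inter,
    Real.volume_Ioc, sub_zero, ENNReal.ofReal_one, mul_one]
  rw [← ofReal_integral_eq_lintegral_ofReal
    (((integrable_norm_mul_gaussian (half_pos hκ)).const_mul 2).div_const _)
    (.of_forall fun y => by positivity), integral_div, integral_const_mul]
  rfl

theorem sub_gaussAvg_eq {F : (Fin n → ℂ) → ℂ} (hF : ContDiff ℝ 1 F) (hs : HasCompactSupport F)
    {ξ κ : ℝ} (hκ : 0 < κ) (z : Fin n → ℂ) :
    gaussAvg ξ κ F z - F z = (gaussMass n κ : ℂ)⁻¹ *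
      ∫ p : ℝ × (Fin n → ℂ), (Real.exp (-κ * nsq p.2) : ℂ) *
        (2 * ∑ j, (starRingEnd ℂ) (p.2 j) *
          (twist ξ z (p.1 • p.2) * twistedDbar ξ j F (z + p.1 • p.2)))
        ∂((volume.restrict (Set.Ioc 0 1)).prod volume) := by
  have hG : (gaussMass n κ : ℂ) ≠ 0 := by exact_mod_cast (gaussMass_pos hκ).ne'
  have h := gaussian_mean_value (contDiff_twist_mul hF ξ z) (hasCompactSupport_twist_mul hs ξ z) hκ
  simp only [dbar_twist_mul hF] at h
  rw [← h, integral_complex_ofReal, gaussAvg]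
  have h0 : twist ξ z 0 = 1 := by simp [twist, imPair, nsq]
  change _ = (gaussMass n κ : ℂ)⁻¹ * (_ - (gaussMass n κ : ℂ) * _)
  rw [mul_sub, ← mul_assoc _ (gaussMass n κ : ℂ), inv_mul_cancel₀ hG, h0]
  simp [gaussMass]

theorem enorm_sub_gaussAvg_le {F : (Fin n → ℂ) → ℂ} (hF : ContDiff ℝ 1 F)
    (hs : HasCompactSupport F) {ξ κ : ℝ} (hκ : 0 < κ) (hξ : 2 * ξ ≤ κ) (z : Fin n → ℂ) :
    ‖F z - gaussAvg ξ κ F z‖ₑ ≤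
      ∫⁻ p, ∑ j, ‖twistedDbar ξ j F (z + p.1 • p.2)‖ₑ ∂(sliceMeasure n κ) := by
  have hG := gaussMass_pos (n := n) hκ
  rw [enorm_sub_rev, sub_gaussAvg_eq hF hs hκ, ← integral_const_mul]
  refine (enorm_integral_le_lintegral_enorm _).trans ?_
  have hm : Measurable fun p : ℝ × (Fin n → ℂ) => ∑ j, ‖twistedDbar ξ j F (z + p.1 • p.2)‖ₑ :=
    Finset.measurable_sum _ fun j _ =>
      (((continuous_twistedDbar hF ξ j).comp (by fun_prop)).measurable).enorm
  rw [sliceMeasure, lintegral_withDensity_eq_lintegral_mul _ (measurable_sliceDensity κ) hm]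
  have hIoc : ∀ᵐ p : ℝ × (Fin n → ℂ) ∂((volume.restrict (Set.Ioc (0 : ℝ) 1)).prod volume),
      p.1 ∈ Set.Ioc (0 : ℝ) 1 :=
    Measure.quasiMeasurePreserving_fst.ae (ae_restrict_mem measurableSet_Ioc)
  refine lintegral_mono_ae (hIoc.mono fun p hp => ?_)
  simp only [Pi.mul_apply]
  have hr2 : p.1 ^ 2 ≤ 1 := by nlinarith [hp.1, hp.2]
  have hexp : Real.exp (-κ * nsq p.2) * Real.exp (ξ * nsq (p.1 • p.2)) ≤
      Real.exp (-(κ / 2) * nsq p.2) := by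
    rw [← Real.exp_add, Real.exp_le_exp, nsq_real_smul]
    have hn := nsq_nonneg p.2
    have : ξ * p.1 ^ 2 ≤ κ / 2 := by nlinarith [sq_nonneg p.1]
    nlinarith
  rw [← ofReal_norm]
  simp only [← ofReal_norm]
  rw [← ENNReal.ofReal_sum_of_nonneg (fun _ _ => norm_nonneg _),
    ← ENNReal.ofReal_mul (by positivity)]
  refine ENNReal.ofReal_le_ofReal ?_
  rw [norm_mul, norm_mul, norm_mul, norm_inv, Complex.norm_real, Complex.norm_real,
    Real.norm_of_nonneg hG.le, Real.norm_of_nonneg (Real.exp_pos _).le]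
  have hsum : ‖∑ j, (starRingEnd ℂ) (p.2 j) *
      (twist ξ z (p.1 • p.2) * twistedDbar ξ j F (z + p.1 • p.2))‖ ≤
      ‖p.2‖ * Real.exp (ξ * nsq (p.1 • p.2)) * ∑ j, ‖twistedDbar ξ j F (z + p.1 • p.2)‖ := by
    rw [Finset.mul_sum]
    refine norm_sum_le_of_le _ fun j _ => ?_
    rw [norm_mul, norm_mul, norm_twist, RCLike.norm_conj, mul_assoc]
    gcongr
    exact norm_eval_le_norm _ _
  calc _ ≤ (gaussMass n κ)⁻¹ * (Real.exp (-κ * nsq p.2) * (2 * (‖p.2‖ *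
        Real.exp (ξ * nsq (p.1 • p.2)) * ∑ j, ‖twistedDbar ξ j F (z + p.1 • p.2)‖))) := by
        rw [Complex.norm_ofNat]
        gcongr
    _ = 2 * (‖p.2‖ * (Real.exp (-κ * nsq p.2) * Real.exp (ξ * nsq (p.1 • p.2)))) /
        gaussMass n κ * ∑ j, ‖twistedDbar ξ j F (z + p.1 • p.2)‖ := by ring
    _ ≤ _ := by gcongr

/-- Gaussian averages approximate a function in `L²` up to the size of its twisted
Cauchy–Riemann derivatives. -/
theorem lintegral_enorm_sub_gaussAvg_sq_le {F : (Fin n → ℂ) → ℂ} (hF : ContDiff ℝ 1 F)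
    (hs : HasCompactSupport F) {ξ κ : ℝ} (hκ : 0 < κ) (hξ : 2 * ξ ≤ κ) :
    ∫⁻ z, ‖F z - gaussAvg ξ κ F z‖ₑ ^ 2 ≤
      ENNReal.ofReal (sliceConst n / κ) * (n * ∑ j, ∫⁻ z, ‖twistedDbar ξ j F z‖ₑ ^ 2) := by
  have hm : ∀ j, Measurable fun z => ‖twistedDbar ξ j F z‖ₑ := fun j =>
    (continuous_twistedDbar hF ξ j).measurable.enorm
  have hd : SFinite (sliceMeasure n κ) := by unfold sliceMeasure; infer_instance
  calc ∫⁻ z, ‖F z - gaussAvg ξ κ F z‖ₑ ^ 2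
      ≤ ∫⁻ z, (∫⁻ p, ∑ j, ‖twistedDbar ξ j F (z + p.1 • p.2)‖ₑ ∂(sliceMeasure n κ)) ^ 2 := by
        gcongr with z
        exact enorm_sub_gaussAvg_le hF hs hκ hξ z
    _ ≤ sliceMeasure n κ Set.univ ^ 2 * ∫⁻ z, (∑ j, ‖twistedDbar ξ j F z‖ₑ) ^ 2 :=
        lintegral_sq_lintegral_translate_le (sliceMeasure n κ) volume
          (h := fun z => ∑ j, ‖twistedDbar ξ j F z‖ₑ) (τ := fun p => p.1 • p.2)
          (Finset.measurable_sum _ fun j _ => hm j) (by fun_prop)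
    _ ≤ _ := by
        rw [sliceMeasure_univ hκ, ← ENNReal.ofReal_pow (by
          have := gaussMass_pos (n := n) hκ
          have := gaussMoment_nonneg (n := n) (κ / 2)
          positivity), sq_gaussMoment_div hκ]
        gcongr
        rw [← lintegral_finsetSum _ (fun j _ => (hm j).pow_const 2),
          ← lintegral_const_mul _ (Finset.measurable_sum _ fun j _ => (hm j).pow_const 2)]
        gcongr with z
        simpa using sq_sum_le_card_mul_sum_sq_ennreal Finset.univ fun j => ‖twistedDbar ξ j F z‖ₑ

/-- The measure on `ℂⁿ` that dominates a twisted Gaussian average. -/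
def avgMeasure (n : ℕ) (ξ κ : ℝ) : Measure (Fin n → ℂ) :=
  volume.withDensity fun y => ENNReal.ofReal (Real.exp (-(κ - ξ) * nsq y) / gaussMass n κ)

theorem measurable_avgDensity (ξ κ : ℝ) : Measurable fun y : Fin n → ℂ =>
    ENNReal.ofReal (Real.exp (-(κ - ξ) * nsq y) / gaussMass n κ) := by
  have := (continuous_nsq (n := n)).measurable
  fun_prop

theorem avgMeasure_univ {ξ κ : ℝ} (hκ : 0 < κ) (hξ : ξ < κ) :
    avgMeasure n ξ κ Set.univ = ENNReal.ofReal ((κ / (κ - ξ)) ^ n) := by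
  have hG := gaussMass_pos (n := n) hκ
  have hG1 := gaussMass_pos (n := n) one_pos
  have hs : 0 < κ - ξ := sub_pos.2 hξ
  rw [avgMeasure, withDensity_apply _ MeasurableSet.univ, setLIntegral_univ,
    ← ofReal_integral_eq_lintegral_ofReal ((integrable_gaussian hs).div_const _)
    (.of_forall fun y => by positivity), integral_div]
  change ENNReal.ofReal (gaussMass n (κ - ξ) / gaussMass n κ) = _
  rw [gaussMass_eq hs, gaussMass_eq hκ, div_pow]
  congr 1
  field_simp

theorem enorm_gaussAvg_le {F : (Fin n → ℂ) → ℂ} (hF : Measurable F) {ξ κ : ℝ} (hκ : 0 < κ)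
    (z : Fin n → ℂ) : ‖gaussAvg ξ κ F z‖ₑ ≤ ∫⁻ y, ‖F (z + y)‖ₑ ∂(avgMeasure n ξ κ) := by
  have hG := gaussMass_pos (n := n) hκ
  rw [gaussAvg, ← integral_const_mul]
  refine (enorm_integral_le_lintegral_enorm _).trans ?_
  rw [avgMeasure, lintegral_withDensity_eq_lintegral_mul _ (measurable_avgDensity ξ κ)
    (by fun_prop)]
  refine lintegral_mono fun y => ?_
  simp only [Pi.mul_apply]
  rw [← ofReal_norm, ← ofReal_norm, ← ENNReal.ofReal_mul (by positivity)]
  refine ENNReal.ofReal_le_ofReal (le_of_eq ?_)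
  change ‖(gaussMass n κ : ℂ)⁻¹ * _‖ = _
  rw [norm_mul, norm_mul, norm_mul, norm_inv, Complex.norm_real, Complex.norm_real,
    Real.norm_of_nonneg hG.le, Real.norm_of_nonneg (Real.exp_pos _).le, norm_twist,
    show -(κ - ξ) * nsq y = -κ * nsq y + ξ * nsq y by ring, Real.exp_add]
  ring

theorem lintegral_enorm_gaussAvg_sq_le {F : (Fin n → ℂ) → ℂ} (hF : Measurable F) {ξ κ : ℝ}
    (hκ : 0 < κ) (hξ : ξ < κ) : ∫⁻ z, ‖gaussAvg ξ κ F z‖ₑ ^ 2 ≤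
      ENNReal.ofReal ((κ / (κ - ξ)) ^ n) ^ 2 * ∫⁻ z, ‖F z‖ₑ ^ 2 := by
  have hd : SFinite (avgMeasure n ξ κ) := by unfold avgMeasure; infer_instance
  rw [← avgMeasure_univ hκ hξ]
  refine le_trans ?_ (lintegral_sq_lintegral_translate_le (avgMeasure n ξ κ) volume
    (h := fun z => ‖F z‖ₑ) (τ := fun y => y) hF.enorm measurable_id)
  gcongr with z
  exact enorm_gaussAvg_le hF hκ z

theorem measurable_gaussAvg {F : (Fin n → ℂ) → ℂ} (hF : Measurable F) (ξ κ : ℝ) :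
    Measurable (gaussAvg ξ κ F) := by
  have h1 := (contDiff_twist (n := n) ξ).continuous.measurable
  have h2 := (continuous_nsq (n := n)).measurable
  have h3 : StronglyMeasurable fun p : (Fin n → ℂ) × (Fin n → ℂ) =>
      (Real.exp (-κ * nsq p.2) : ℂ) * (twist ξ p.1 p.2 * F (p.1 + p.2)) := by
    refine Measurable.stronglyMeasurable ?_
    refine Measurable.mul (by fun_prop) (h1.mul (by fun_prop))
  exact (h3.integral_prod_right (ν := volume)).measurable.const_mul _

/-- For negative frequencies the twisted Cauchy–Riemann operators are coercive. -/
theorem lintegral_enorm_sq_le_of_neg [NeZero n] {F : (Fin n → ℂ) → ℂ} (hF : ContDiff ℝ 1 F)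
    (hs : HasCompactSupport F) {ξ : ℝ} (hξ : ξ < 0) :
    ∫⁻ z, ‖F z‖ₑ ^ 2 ≤
      4 * (ENNReal.ofReal (sliceConst n / (-ξ)) *
        (n * ∑ j, ∫⁻ z, ‖twistedDbar ξ j F z‖ₑ ^ 2)) := by
  have hκ : 0 < -ξ := neg_pos.2 hξ
  have h1 := lintegral_enorm_sub_gaussAvg_sq_le hF hs hκ (show 2 * ξ ≤ -ξ by linarith)
  have h2 := lintegral_enorm_gaussAvg_sq_le hF.continuous.measurable hκ (show ξ < -ξ by linarith)
  have hc : ENNReal.ofReal ((-ξ / (-ξ - ξ)) ^ n) ^ 2 ≤ 4⁻¹ := by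
    have e : -ξ / (-ξ - ξ) = 1 / 2 := by
      rw [div_eq_div_iff (by linarith) (by norm_num)]; ring
    rw [e, ← ENNReal.ofReal_pow (by positivity), ← pow_mul]
    have h4 : (4 : ℝ≥0∞)⁻¹ = ENNReal.ofReal ((1 / 2) ^ 2) := by
      rw [ENNReal.ofReal_pow (by norm_num), one_div, ENNReal.ofReal_inv_of_pos (by norm_num),
        ← ENNReal.inv_pow]
      norm_num
    rw [h4]
    refine ENNReal.ofReal_le_ofReal (pow_le_pow_of_le_one (by norm_num) (by norm_num) ?_)
    have := NeZero.one_le (n := n)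
    omega
  have hfin : ∫⁻ z, ‖F z‖ₑ ^ 2 ≠ ⊤ := by
    rw [← eLpNorm_two_sq]
    exact (ENNReal.pow_lt_top (hF.continuous.memLp_of_hasCompactSupport hs).2).ne
  have hb : ∫⁻ z, ‖F z‖ₑ ^ 2 ≤ 2 * ((∫⁻ z, ‖F z - gaussAvg ξ (-ξ) F z‖ₑ ^ 2) +
      4⁻¹ * ∫⁻ z, ‖F z‖ₑ ^ 2) := by
    calc ∫⁻ z, ‖F z‖ₑ ^ 2
        ≤ ∫⁻ z, 2 * (‖F z - gaussAvg ξ (-ξ) F z‖ₑ ^ 2 + ‖gaussAvg ξ (-ξ) F z‖ₑ ^ 2) := by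
          refine lintegral_mono fun z => le_trans ?_ (add_sq_le_ennreal _ _)
          gcongr
          conv_lhs => rw [← sub_add_cancel (F z) (gaussAvg ξ (-ξ) F z)]
          exact enorm_add_le _ _
      _ = 2 * ((∫⁻ z, ‖F z - gaussAvg ξ (-ξ) F z‖ₑ ^ 2) +
          ∫⁻ z, ‖gaussAvg ξ (-ξ) F z‖ₑ ^ 2) := by
          have hA : Measurable fun z => gaussAvg ξ (-ξ) F z :=
            measurable_gaussAvg hF.continuous.measurable ξ (-ξ)
          have hFm := hF.continuous.measurable
          rw [lintegral_const_mul _ (by fun_prop), lintegral_add_right _ (by fun_prop)]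
      _ ≤ _ := by
          gcongr
          exact h2.trans (by gcongr)
  refine le_trans ?_ (mul_le_mul_right h1 4)
  exact le_four_mul_of_le hfin hb

end SliceBounds

section PartialFourier

variable {n : ℕ}

/-- The Fourier transform in the central variable. -/
def tFourier (w : Hgrp n → ℂ) (z : Fin n → ℂ) (η : ℝ) : ℂ :=
  ∫ t : ℝ, Complex.exp (((-2 * Real.pi * t * η : ℝ) : ℂ) * Complex.I) * w (z, t)

open FourierTransform in
theorem tFourier_eq_fourier (w : Hgrp n → ℂ) (z : Fin n → ℂ) (η : ℝ) :
    tFourier w z η = 𝓕 (fun t => w (z, t)) η := by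
  rw [Real.fourier_real_eq_integral_exp_smul]
  rfl

theorem exists_compact_prod {E : Type*} [Zero E] {w : Hgrp n → E} (hs : HasCompactSupport w) :
    ∃ (K : Set (Fin n → ℂ)) (T : Set ℝ), IsCompact K ∧ IsCompact T ∧
      ∀ z t, (z ∉ K ∨ t ∉ T) → w (z, t) = 0 := by
  refine ⟨Prod.fst '' tsupport w, Prod.snd '' tsupport w, hs.isCompact.image continuous_fst,
    hs.isCompact.image continuous_snd, fun z t h => image_eq_zero_of_notMem_tsupport fun hm => ?_⟩
  rcases h with h | h
  · exact h ⟨_, hm, rfl⟩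
  · exact h ⟨_, hm, rfl⟩

theorem continuous_slice {E : Type*} [TopologicalSpace E] {w : Hgrp n → E} (hw : Continuous w)
    (z : Fin n → ℂ) : Continuous fun t => w (z, t) := by fun_prop

theorem hasCompactSupport_slice {E : Type*} [Zero E] {w : Hgrp n → E}
    (hs : HasCompactSupport w) (z : Fin n → ℂ) : HasCompactSupport fun t => w (z, t) := by
  obtain ⟨K, T, -, hT, h⟩ := exists_compact_prod hs
  exact HasCompactSupport.intro hT fun t ht => h z t (Or.inr ht)

theorem integrable_slice {w : Hgrp n → ℂ} (hw : Continuous w) (hs : HasCompactSupport w)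
    (z : Fin n → ℂ) : Integrable fun t => w (z, t) :=
  (continuous_slice hw z).integrable_of_hasCompactSupport (hasCompactSupport_slice hs z)

theorem continuous_integral_exp_smul {E : Type*} [NormedAddCommGroup E] [NormedSpace ℂ E]
    {w : Hgrp n → E} (hw : Continuous w) (hs : HasCompactSupport w) :
    Continuous fun p : Hgrp n => ∫ t : ℝ,
      Complex.exp (((-2 * Real.pi * t * p.2 : ℝ) : ℂ) * Complex.I) • w (p.1, t) := by
  obtain ⟨K, T, -, hT, h⟩ := exists_compact_prod hs
  have := continuous_parametric_integral_of_continuous (μ := volume)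
    (f := fun (p : Hgrp n) (t : ℝ) =>
      Complex.exp (((-2 * Real.pi * t * p.2 : ℝ) : ℂ) * Complex.I) • w (p.1, t))
    (by fun_prop) hT
  refine this.congr fun p => setIntegral_eq_integral_of_forall_compl_eq_zero fun t ht => ?_
  rw [h _ _ (Or.inr ht), smul_zero]

theorem continuous_tFourier {w : Hgrp n → ℂ} (hw : Continuous w) (hs : HasCompactSupport w) :
    Continuous fun p : Hgrp n => tFourier w p.1 p.2 :=
  continuous_integral_exp_smul hw hs

theorem hasFDerivAt_tFourier {v : Hgrp n → ℂ} (hv : ContDiff ℝ 1 v) (hs : HasCompactSupport v)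
    (η : ℝ) (z : Fin n → ℂ) :
    HasFDerivAt (fun z => tFourier v z η) (∫ t : ℝ,
      Complex.exp (((-2 * Real.pi * t * η : ℝ) : ℂ) * Complex.I) •
        (fderiv ℝ v (z, t)).comp (ContinuousLinearMap.inl ℝ (Fin n → ℂ) ℝ)) z := by
  obtain ⟨K, T, -, hT, h⟩ := exists_compact_prod (hs.fderiv (𝕜 := ℝ))
  have hfd : Continuous (fderiv ℝ v) := hv.continuous_fderiv one_ne_zero
  obtain ⟨M, hM⟩ := hfd.bounded_above_of_compact_support (hs.fderiv (𝕜 := ℝ))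
  have hE : ∀ t : ℝ, ‖Complex.exp (((-2 * Real.pi * t * η : ℝ) : ℂ) * Complex.I)‖ = 1 :=
    fun t => Complex.norm_exp_ofReal_mul_I _
  unfold tFourier
  refine hasFDerivAt_integral_of_dominated_of_fderiv_le (s := Set.univ)
    (bound := T.indicator fun _ => M * ‖ContinuousLinearMap.inl ℝ (Fin n → ℂ) ℝ‖)
    (F' := fun z t => Complex.exp (((-2 * Real.pi * t * η : ℝ) : ℂ) * Complex.I) •
        (fderiv ℝ v (z, t)).comp (ContinuousLinearMap.inl ℝ (Fin n → ℂ) ℝ))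
    Filter.univ_mem (.of_forall fun z => ?_) ?_ ?_ (.of_forall fun t z _ => ?_) ?_
    (.of_forall fun t z _ => ?_)
  · exact Continuous.aestronglyMeasurable (by have := hv.continuous; fun_prop)
  · refine (integrable_slice hv.continuous hs z).norm.mono'
      (Continuous.aestronglyMeasurable (by have := hv.continuous; fun_prop))
      (.of_forall fun t => ?_)
    rw [norm_mul, hE, one_mul]
  · exact Continuous.aestronglyMeasurable (by fun_prop)
  · rw [norm_smul, hE, one_mul]
    by_cases ht : t ∈ T
    · rw [Set.indicator_of_mem ht]
      exact (ContinuousLinearMap.opNorm_comp_le _ _).trans (by gcongr; exact hM _)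
    · rw [Set.indicator_of_notMem ht, h _ _ (Or.inr ht)]
      simp
  · exact (integrable_indicator_iff hT.measurableSet).2
      (integrableOn_const hT.measure_lt_top.ne)
  · have h1 : HasFDerivAt (fun z : Fin n → ℂ => v (z, t))
        ((fderiv ℝ v (z, t)).comp (ContinuousLinearMap.inl ℝ (Fin n → ℂ) ℝ)) z :=
      (hv.differentiable one_ne_zero (z, t)).hasFDerivAt.comp z (hasFDerivAt_prodMk_left z t)
    exact h1.const_mul _

theorem contDiff_tFourier {v : Hgrp n → ℂ} (hv : ContDiff ℝ 1 v) (hs : HasCompactSupport v)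
    (η : ℝ) : ContDiff ℝ 1 fun z => tFourier v z η := by
  rw [contDiff_one_iff_fderiv]
  refine ⟨fun z => (hasFDerivAt_tFourier hv hs η z).differentiableAt, ?_⟩
  have hfd : Continuous (fderiv ℝ v) := hv.continuous_fderiv one_ne_zero
  have e : fderiv ℝ (fun z => tFourier v z η) = fun z => ∫ t : ℝ,
      Complex.exp (((-2 * Real.pi * t * η : ℝ) : ℂ) * Complex.I) •
        (fderiv ℝ v (z, t)).comp (ContinuousLinearMap.inl ℝ (Fin n → ℂ) ℝ) := by
    funext z
    exact (hasFDerivAt_tFourier hv hs η z).fderiv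
  rw [e]
  exact (continuous_integral_exp_smul
    (w := fun p => (fderiv ℝ v p).comp (ContinuousLinearMap.inl ℝ (Fin n → ℂ) ℝ)) (by fun_prop)
    ((hs.fderiv (𝕜 := ℝ)).comp_left
      (g := fun A : Hgrp n →L[ℝ] ℂ => A.comp (ContinuousLinearMap.inl ℝ (Fin n → ℂ) ℝ))
      (by simp))).comp (by fun_prop : Continuous fun z : Fin n → ℂ => ((z, η) : Hgrp n))

theorem tFourier_eq_zero {w : Hgrp n → ℂ} {z : Fin n → ℂ} (h : ∀ t, w (z, t) = 0) (η : ℝ) :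
    tFourier w z η = 0 := by
  simp [tFourier, h]

theorem hasCompactSupport_tFourier {w : Hgrp n → ℂ} (hs : HasCompactSupport w) (η : ℝ) :
    HasCompactSupport fun z => tFourier w z η := by
  obtain ⟨K, T, hK, -, h⟩ := exists_compact_prod hs
  exact HasCompactSupport.intro hK fun z hz => tFourier_eq_zero (fun t => h z t (Or.inl hz)) η

theorem fderiv_tFourier_apply {v : Hgrp n → ℂ} (hv : ContDiff ℝ 1 v) (hs : HasCompactSupport v)
    (η : ℝ) (z w : Fin n → ℂ) :
    fderiv ℝ (fun z => tFourier v z η) z w = tFourier (fun p => fderiv ℝ v p (w, 0)) z η := by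
  have hfd : Continuous (fderiv ℝ v) := hv.continuous_fderiv one_ne_zero
  rw [(hasFDerivAt_tFourier hv hs η z).fderiv, ContinuousLinearMap.integral_apply]
  · simp [tFourier]
  · refine Continuous.integrable_of_hasCompactSupport (by fun_prop) ?_
    refine HasCompactSupport.smul_left (f := fun t : ℝ =>
      Complex.exp (((-2 * Real.pi * t * η : ℝ) : ℂ) * Complex.I)) ?_
    exact (hasCompactSupport_slice (hs.fderiv (𝕜 := ℝ)) z).comp_left
      (g := fun A : Hgrp n →L[ℝ] ℂ => A.comp (ContinuousLinearMap.inl ℝ (Fin n → ℂ) ℝ))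
      (by simp)

theorem tFourier_dT {v : Hgrp n → ℂ} (hv : ContDiff ℝ 1 v) (hs : HasCompactSupport v)
    (η : ℝ) (z : Fin n → ℂ) :
    tFourier (dT v) z η = 2 * Real.pi * Complex.I * η * tFourier v z η := by
  have hfd : Continuous (fderiv ℝ v) := hv.continuous_fderiv one_ne_zero
  have hd : ∀ t, HasDerivAt (fun t => v (z, t)) (dT v (z, t)) t := fun t => by
    have := (hv.differentiable one_ne_zero (z, t)).hasFDerivAt.comp t (hasFDerivAt_prodMk_right z t)
    simpa [dT, Function.comp_def] using this.hasDerivAt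
  have hdT : deriv (fun t => v (z, t)) = fun t => dT v (z, t) := funext fun t => (hd t).deriv
  have hsT : HasCompactSupport (dT v) :=
    (hs.fderiv (𝕜 := ℝ)).comp_left (g := fun A : Hgrp n →L[ℝ] ℂ => A (0, 1)) (by simp)
  have h := Real.fourier_deriv (integrable_slice hv.continuous hs z)
    (fun t => (hd t).differentiableAt)
    (by rw [hdT]; exact integrable_slice (by unfold dT; fun_prop) hsT z)
  rw [tFourier_eq_fourier, tFourier_eq_fourier, ← hdT, h]
  rfl

theorem continuous_fderiv_apply_of_contDiff {v : Hgrp n → ℂ} (hv : ContDiff ℝ 1 v) (a : Hgrp n) :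
    Continuous fun p => fderiv ℝ v p a := by
  have hfd : Continuous (fderiv ℝ v) := hv.continuous_fderiv one_ne_zero
  fun_prop

theorem hasCompactSupport_fderiv_apply {v : Hgrp n → ℂ} (hs : HasCompactSupport v)
    (a : Hgrp n) : HasCompactSupport fun p => fderiv ℝ v p a :=
  (hs.fderiv (𝕜 := ℝ)).comp_left (g := fun A : Hgrp n →L[ℝ] ℂ => A a) (by simp)

theorem continuous_Lbar {v : Hgrp n → ℂ} (hv : ContDiff ℝ 1 v) (j : Fin n) :
    Continuous (Lbar j v) := by
  have hfd : Continuous (fderiv ℝ v) := hv.continuous_fderiv one_ne_zero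
  unfold Lbar dZbar dT
  fun_prop

theorem hasCompactSupport_Lbar {v : Hgrp n → ℂ} (hs : HasCompactSupport v) (j : Fin n) :
    HasCompactSupport (Lbar j v) := by
  refine HasCompactSupport.intro hs.isCompact fun p hp => ?_
  have : fderiv ℝ v p = 0 := by
    by_contra h
    exact hp (support_fderiv_subset ℝ h)
  simp [Lbar, dZbar, dT, this]

theorem twistedDbar_tFourier {v : Hgrp n → ℂ} (hv : ContDiff ℝ 1 v) (hs : HasCompactSupport v)
    (j : Fin n) (η : ℝ) (z : Fin n → ℂ) :
    twistedDbar (2 * Real.pi * η) j (fun z => tFourier v z η) z = tFourier (Lbar j v) z η := by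
  have hint : ∀ a : Hgrp n, Integrable fun t : ℝ =>
      Complex.exp (((-2 * Real.pi * t * η : ℝ) : ℂ) * Complex.I) * fderiv ℝ v (z, t) a := by
    intro a
    have h1 := continuous_fderiv_apply_of_contDiff hv a
    refine Continuous.integrable_of_hasCompactSupport (by fun_prop) ?_
    exact (hasCompactSupport_slice (hasCompactSupport_fderiv_apply hs a) z).mul_left
  have e : tFourier (Lbar j v) z η = (1 / 2 : ℂ) *
      (tFourier (fun p => fderiv ℝ v p (Pi.single j 1, 0)) z η +
        Complex.I * tFourier (fun p => fderiv ℝ v p (Pi.single j Complex.I, 0)) z η) -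
      Complex.I * z j * tFourier (dT v) z η := by
    simp only [tFourier, Lbar, dZbar, dT]
    rw [← integral_const_mul Complex.I, ← integral_add (hint _) ((hint _).const_mul _),
      ← integral_const_mul, ← integral_const_mul, ← integral_sub]
    · refine integral_congr_ae (.of_forall fun t => ?_)
      ring
    · exact ((hint _).add ((hint _).const_mul _)).const_mul _
    · exact (hint _).const_mul _
  rw [e, tFourier_dT hv hs, twistedDbar, fderiv_tFourier_apply hv hs, fderiv_tFourier_apply hv hs]
  push_cast
  linear_combination (2 * Real.pi * η * z j * tFourier v z η) * Complex.I_sq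

/-- Plancherel's identity in the central variable. -/
theorem lintegral_enorm_tFourier_sq {w : Hgrp n → ℂ} (hw : Continuous w)
    (hs : HasCompactSupport w) (z : Fin n → ℂ) :
    ∫⁻ η, ‖tFourier w z η‖ₑ ^ 2 = ∫⁻ t, ‖w (z, t)‖ₑ ^ 2 := by
  simp only [tFourier_eq_fourier]
  exact lintegral_enorm_fourier_sq (integrable_slice hw hs z)
    ((continuous_slice hw z).memLp_of_hasCompactSupport (hasCompactSupport_slice hs z))

theorem lintegral_lintegral_enorm_tFourier_sq {w : Hgrp n → ℂ} (hw : Continuous w)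
    (hs : HasCompactSupport w) :
    ∫⁻ η, ∫⁻ z, ‖tFourier w z η‖ₑ ^ 2 = ∫⁻ p, ‖w p‖ₑ ^ 2 := by
  have h1 := continuous_tFourier hw hs
  rw [lintegral_lintegral_swap]
  · simp only [lintegral_enorm_tFourier_sq hw hs]
    rw [Measure.volume_eq_prod, lintegral_prod _ (by have := hw.measurable; fun_prop)]
  · have := (h1.comp continuous_swap).measurable
    exact (this.enorm.pow_const 2).aemeasurable

open FourierTransform in
/-- Fourier inversion in the central variable. -/
theorem fourierInv_tFourier {v : Hgrp n → ℂ} (hv : ContDiff ℝ ∞ v) (hs : HasCompactSupport v)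
    (z : Fin n → ℂ) : Integrable (tFourier v z) ∧ ∀ t, 𝓕⁻ (tFourier v z) t = v (z, t) := by
  have hsl : ContDiff ℝ ∞ fun t => v (z, t) := hv.comp (contDiff_const.prodMk contDiff_id)
  let G : SchwartzMap ℝ ℂ := (hasCompactSupport_slice hs z).toSchwartzMap hsl
  have hG : (tFourier v z) = (𝓕 G : SchwartzMap ℝ ℂ) := by
    funext η
    rw [tFourier_eq_fourier, SchwartzMap.fourier_coe]
    rfl
  have hi : Integrable (tFourier v z) := hG ▸ (𝓕 G).integrable
  refine ⟨hi, fun t => ?_⟩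
  have e : tFourier v z = 𝓕 (fun t => v (z, t)) := funext fun η => tFourier_eq_fourier v z η
  rw [e] at hi ⊢
  exact (integrable_slice hv.continuous hs z).fourierInv_fourier_eq hi
    (continuous_slice hv.continuous z).continuousAt

end PartialFourier

section CRKernel

variable {n : ℕ}

theorem integral_mul_Lbar_eq_neg {k φ : Hgrp n → ℂ} (hk : ContDiff ℝ 1 k) (hφ : ContDiff ℝ 1 φ)
    (hs : HasCompactSupport φ) (j : Fin n) :
    ∫ p, k p * Lbar j φ p = -∫ p, Lbar j k p * φ p := by
  have hz : ContDiff ℝ 1 fun p : Hgrp n => p.1 j := (contDiff_apply ℝ ℂ j).comp contDiff_fst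
  have hμ : (volume : Measure (Hgrp n)).IsAddHaarMeasure := by
    exact Measure.prod.instIsAddHaarMeasure (volume : Measure (Fin n → ℂ)) (volume : Measure ℝ)
  have key : ∀ (m : Hgrp n → ℂ), ContDiff ℝ 1 m → ∀ a : Hgrp n,
      Integrable (fun p => m p * fderiv ℝ φ p a) ∧ Integrable (fun p => fderiv ℝ m p a * φ p) ∧
      ∫ p, m p * fderiv ℝ φ p a = -∫ p, fderiv ℝ m p a * φ p := by
    intro m hm a
    have h1 := continuous_fderiv_apply_of_contDiff hm a
    have h2 := continuous_fderiv_apply_of_contDiff hφ a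
    have h3 := hm.continuous
    have h4 := hφ.continuous
    have i1 : Integrable (fun p => m p * fderiv ℝ φ p a) :=
      Continuous.integrable_of_hasCompactSupport (by fun_prop)
        (hasCompactSupport_fderiv_apply hs a).mul_left
    have i2 : Integrable (fun p => fderiv ℝ m p a * φ p) :=
      Continuous.integrable_of_hasCompactSupport (by fun_prop) hs.mul_left
    have i3 : Integrable (fun p => m p * φ p) :=
      Continuous.integrable_of_hasCompactSupport (by fun_prop) hs.mul_left
    exact ⟨i1, i2, integral_mul_fderiv_eq_neg_fderiv_mul_of_integrable i2 i1 i3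
      (fun x _ => hm.differentiable one_ne_zero x) (fun x _ => hφ.differentiable one_ne_zero x)⟩
  obtain ⟨a1, b1, e1⟩ := key k hk (Pi.single j 1, 0)
  obtain ⟨a2, b2, e2⟩ := key k hk (Pi.single j Complex.I, 0)
  obtain ⟨a3, b3, e3⟩ := key (fun p => p.1 j * k p) (hz.mul hk) (0, 1)
  have hd : ∀ p : Hgrp n, fderiv ℝ (fun p : Hgrp n => p.1 j * k p) p (0, 1) =
      p.1 j * fderiv ℝ k p (0, 1) := by
    intro p
    have hz' : HasFDerivAt (fun p : Hgrp n => p.1 j)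
        ((ContinuousLinearMap.proj (R := ℝ) (φ := fun _ : Fin n => ℂ) j).comp
          (ContinuousLinearMap.fst ℝ (Fin n → ℂ) ℝ)) p :=
      ((ContinuousLinearMap.proj (R := ℝ) (φ := fun _ : Fin n => ℂ) j).comp
          (ContinuousLinearMap.fst ℝ (Fin n → ℂ) ℝ)).hasFDerivAt
    have h := hz'.mul (hk.differentiable one_ne_zero p).hasFDerivAt
    rw [show (fun p : Hgrp n => p.1 j * k p) = (fun p : Hgrp n => p.1 j) * k from rfl, h.fderiv]
    simp
  simp only [hd] at b3 e3
  have l : ∫ p, k p * Lbar j φ p = (1 / 2 : ℂ) *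
      ((∫ p, k p * fderiv ℝ φ p (Pi.single j 1, 0)) +
        Complex.I * ∫ p, k p * fderiv ℝ φ p (Pi.single j Complex.I, 0)) -
      Complex.I * ∫ p, p.1 j * k p * fderiv ℝ φ p (0, 1) := by
    rw [← integral_const_mul, ← integral_add a1 (a2.const_mul _), ← integral_const_mul,
      ← integral_const_mul]
    refine Eq.trans ?_ (integral_sub ((a1.add (a2.const_mul _)).const_mul _) (a3.const_mul _))
    refine integral_congr_ae (.of_forall fun p => ?_)
    simp only [Lbar, dZbar, dT]
    ring
  have r : ∫ p, Lbar j k p * φ p = (1 / 2 : ℂ) *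
      ((∫ p, fderiv ℝ k p (Pi.single j 1, 0) * φ p) +
        Complex.I * ∫ p, fderiv ℝ k p (Pi.single j Complex.I, 0) * φ p) -
      Complex.I * ∫ p, p.1 j * fderiv ℝ k p (0, 1) * φ p := by
    rw [← integral_const_mul, ← integral_add b1 (b2.const_mul _), ← integral_const_mul,
      ← integral_const_mul]
    refine Eq.trans ?_ (integral_sub ((b1.add (b2.const_mul _)).const_mul _) (b3.const_mul _))
    refine integral_congr_ae (.of_forall fun p => ?_)
    simp only [Lbar, dZbar, dT]
    ring
  rw [l, r, e1, e2, e3]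
  ring

/-- An integrable superposition of bounded `C¹` solutions of the tangential Cauchy–Riemann
equations is CR. -/
theorem isCRfun_integral {Q : Type*} [MeasurableSpace Q] {μ : Measure Q} [SFinite μ] {H : Q → ℂ}
    (hH : Integrable H μ) {k : Q → Hgrp n → ℂ}
    (hkm : AEStronglyMeasurable (Function.uncurry k) (μ.prod volume))
    (hk1 : ∀ᵐ q ∂μ, ∀ p, ‖k q p‖ ≤ 1) (hkd : ∀ q, ContDiff ℝ 1 (k q))
    (hkL : ∀ q j p, Lbar j (k q) p = 0) : IsCRfun fun p => ∫ q, H q * k q p ∂μ := by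
  intro j φ hφ hs
  have hφ1 : ContDiff ℝ 1 φ := hφ.of_le (by norm_cast)
  have hL : Integrable (Lbar j φ) :=
    (continuous_Lbar hφ1 j).integrable_of_hasCompactSupport (hasCompactSupport_Lbar hs j)
  have hint : Integrable (fun x : Q × Hgrp n => H x.1 * k x.1 x.2 * Lbar j φ x.2)
      (μ.prod volume) := by
    have := (hH.mul_prod hL).bdd_mul (c := 1) hkm (by
      have h := (Measure.quasiMeasurePreserving_fst (μ := μ)
        (ν := (volume : Measure (Hgrp n)))).ae hk1
      filter_upwards [h] with x hx using hx x.2)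
    refine this.congr (.of_forall fun x => ?_)
    simp only [Function.uncurry]
    ring
  calc ∫ p, (∫ q, H q * k q p ∂μ) * Lbar j φ p
      = ∫ p, ∫ q, H q * k q p * Lbar j φ p ∂μ := by
        simp only [integral_mul_const]
    _ = ∫ q, (∫ p, H q * k q p * Lbar j φ p) ∂μ := (integral_integral_swap hint).symm
    _ = 0 := by
        refine integral_eq_zero_of_ae (.of_forall fun q => ?_)
        simp only [mul_assoc, integral_const_mul, integral_mul_Lbar_eq_neg (hkd q) hφ1 hs, hkL]
        simp

/-- The Fourier component at frequency `η > 0` of the reproducing kernel of CR functions, up to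
normalization. -/
def crKernel (q : ℝ × (Fin n → ℂ)) (p : Hgrp n) : ℂ :=
  Complex.exp (-(2 * Real.pi * q.1) * (nsq p.1 + nsq q.2 -
    2 * (∑ j, p.1 j * (starRingEnd ℂ) (q.2 j)) - Complex.I * p.2))

theorem contDiff_crKernel (q : ℝ × (Fin n → ℂ)) : ContDiff ℝ 1 (crKernel q) := by
  have h1 : ContDiff ℝ 1 fun p : Hgrp n => (nsq p.1 : ℂ) :=
    (Complex.ofRealCLM.contDiff.comp (contDiff_nsq.comp contDiff_fst)).of_le (by norm_cast)
  have h2 : ContDiff ℝ 1 fun p : Hgrp n => (p.2 : ℂ) :=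
    Complex.ofRealCLM.contDiff.comp contDiff_snd
  have h3 : ContDiff ℝ 1 fun p : Hgrp n => ∑ j, p.1 j * (starRingEnd ℂ) (q.2 j) :=
    ContDiff.sum fun j _ => ((contDiff_apply ℝ ℂ j).comp contDiff_fst).mul contDiff_const
  unfold crKernel
  fun_prop

theorem continuous_crKernel :
    Continuous fun x : (ℝ × (Fin n → ℂ)) × Hgrp n => crKernel x.1 x.2 := by
  have := continuous_nsq (n := n)
  unfold crKernel
  fun_prop

theorem fderiv_crKernel (q : ℝ × (Fin n → ℂ)) (p a : Hgrp n) :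
    fderiv ℝ (crKernel q) p a = crKernel q p * (-(2 * Real.pi * q.1) *
      (2 * (∑ j, ((starRingEnd ℂ) (p.1 j) * a.1 j).re : ℝ) -
        2 * (∑ j, a.1 j * (starRingEnd ℂ) (q.2 j)) - Complex.I * a.2)) := by
  have hline : HasDerivAt (fun s : ℝ => p + s • a) a 0 := by
    simpa using ((hasDerivAt_id (0 : ℝ)).smul_const a).const_add p
  have e1 : HasDerivAt (fun s : ℝ => crKernel q (p + s • a)) (fderiv ℝ (crKernel q) p a) 0 := by
    have h := ((contDiff_crKernel q).differentiable one_ne_zero (p + (0 : ℝ) • a)).hasFDerivAt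
    have := h.comp_hasDerivAt (0 : ℝ) hline
    simpa [Function.comp_def] using this
  refine e1.unique ?_
  have hs : HasDerivAt (fun s : ℝ => (s : ℂ)) 1 0 := by
    simpa using (hasDerivAt_id (0 : ℝ)).ofReal_comp
  have hsum : ∀ s : ℝ, ∑ j, (p + s • a).1 j * (starRingEnd ℂ) (q.2 j) =
      (∑ j, p.1 j * (starRingEnd ℂ) (q.2 j)) + s * ∑ j, a.1 j * (starRingEnd ℂ) (q.2 j) := by
    intro s
    rw [Finset.mul_sum, ← Finset.sum_add_distrib]
    refine Finset.sum_congr rfl fun j _ => ?_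
    simp
    ring
  have hnsq : ∀ s : ℝ, nsq (p + s • a).1 = nsq p.1 +
      s * (2 * ∑ j, ((starRingEnd ℂ) (p.1 j) * a.1 j).re) + s ^ 2 * nsq a.1 := fun s =>
    nsq_add_smul p.1 a.1 s
  simp only [crKernel, hsum, hnsq]
  set A : ℝ := ∑ j, ((starRingEnd ℂ) (p.1 j) * a.1 j).re
  set D : ℂ := ∑ j, a.1 j * (starRingEnd ℂ) (q.2 j)
  set D' : ℂ := ∑ j, p.1 j * (starRingEnd ℂ) (q.2 j)
  have h4 : HasDerivAt (fun s : ℝ => -(2 * (Real.pi : ℂ) * q.1) *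
      (((nsq p.1 : ℂ) + s * (2 * A) + s ^ 2 * nsq a.1) + nsq q.2 - 2 * (D' + s * D) -
        Complex.I * (p.2 + s * a.2)))
      (-(2 * (Real.pi : ℂ) * q.1) * (2 * A - 2 * D - Complex.I * a.2)) 0 := by
    have := ((((((hs.mul_const (2 * (A : ℂ))).const_add (nsq p.1 : ℂ)).add
      ((hs.pow 2).mul_const (nsq a.1 : ℂ))).add_const (nsq q.2 : ℂ)).sub
      (((hs.mul_const D).const_add D').const_mul 2)).sub
      (((hs.mul_const (a.2 : ℂ)).const_add (p.2 : ℂ)).const_mul Complex.I)).const_mul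
      (-(2 * (Real.pi : ℂ) * q.1))
    simpa using this
  have h5 := h4.cexp
  simpa using h5

theorem Lbar_crKernel (q : ℝ × (Fin n → ℂ)) (j : Fin n) (p : Hgrp n) :
    Lbar j (crKernel q) p = 0 := by
  simp only [Lbar, dZbar, dT, fderiv_crKernel]
  have h1 : ∀ c : ℂ, ∑ i, ((starRingEnd ℂ) (p.1 i) * (Pi.single j c : Fin n → ℂ) i).re =
      ((starRingEnd ℂ) (p.1 j) * c).re := fun c => by
    rw [Finset.sum_eq_single j (by intro b _ hb; simp [hb]) (by simp)]; simp
  have h2 : ∀ c : ℂ, ∑ i, (Pi.single j c : Fin n → ℂ) i * (starRingEnd ℂ) (q.2 i) =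
      c * (starRingEnd ℂ) (q.2 j) := fun c => by
    rw [Finset.sum_eq_single j (by intro b _ hb; simp [hb]) (by simp)]; simp
  simp only [h1, h2]
  have h3 : ((((starRingEnd ℂ) (p.1 j) * 1).re : ℝ) : ℂ) +
      Complex.I * ((((starRingEnd ℂ) (p.1 j) * Complex.I).re : ℝ) : ℂ) = p.1 j := by
    apply Complex.ext <;> simp
  simp only [Pi.zero_apply, mul_zero, zero_mul, Complex.zero_re, Finset.sum_const_zero,
    Complex.ofReal_zero, Complex.ofReal_one]
  have h4 := Complex.I_sq
  linear_combination (-(2 * (Real.pi : ℂ) * q.1) * crKernel q p) * h3 +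
    (crKernel q p * (2 * (Real.pi : ℂ) * q.1)) * ((starRingEnd ℂ) (q.2 j) - p.1 j) * h4

theorem norm_crKernel (q : ℝ × (Fin n → ℂ)) (p : Hgrp n) :
    ‖crKernel q p‖ = Real.exp (-(2 * Real.pi * q.1) * nsq (q.2 - p.1)) := by
  have e : nsq (q.2 - p.1) = nsq p.1 + nsq q.2 -
      2 * ∑ j, (p.1 j * (starRingEnd ℂ) (q.2 j)).re := by
    simp only [nsq, Finset.mul_sum, ← Finset.sum_add_distrib, ← Finset.sum_sub_distrib]
    refine Finset.sum_congr rfl fun j _ => ?_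
    simp [Complex.normSq_apply]
    ring
  rw [crKernel, Complex.norm_exp, e]
  congr 1
  rw [show -(2 * (Real.pi : ℂ) * q.1) = ((-(2 * Real.pi * q.1) : ℝ) : ℂ) by push_cast; ring,
    Complex.re_ofReal_mul]
  simp

theorem norm_crKernel_le_one {q : ℝ × (Fin n → ℂ)} (hq : 0 ≤ q.1) (p : Hgrp n) :
    ‖crKernel q p‖ ≤ 1 := by
  rw [norm_crKernel, Real.exp_le_one_iff]
  have := nsq_nonneg (q.2 - p.1)
  have := Real.pi_pos
  have : 0 ≤ 2 * Real.pi * q.1 * nsq (q.2 - p.1) := by positivity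
  linarith

theorem gaussAvg_eq_integral_crKernel {η : ℝ} (hη : 0 < η) (F : (Fin n → ℂ) → ℂ)
    (z : Fin n → ℂ) :
    gaussAvg (2 * Real.pi * η) (4 * Real.pi * η) F z =
      (((4 * Real.pi * η) ^ n / gaussMass n 1 : ℝ) : ℂ) *
        ∫ w, F w * crKernel (η, w) (z, 0) := by
  have hκ : 0 < 4 * Real.pi * η := by have := Real.pi_pos; positivity
  have h1 := gaussMass_pos (n := n) one_pos
  have hc : ((gaussMass n (4 * Real.pi * η) : ℝ) : ℂ)⁻¹ =
      (((4 * Real.pi * η) ^ n / gaussMass n 1 : ℝ) : ℂ) := by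
    rw [gaussMass_eq hκ, ← Complex.ofReal_inv]
    congr 1
    field_simp
  rw [gaussAvg, ← hc]
  change (gaussMass n (4 * Real.pi * η) : ℂ)⁻¹ * _ = _
  rw [← integral_sub_right_eq_self (fun y => (Real.exp (-(4 * Real.pi * η) * nsq y) : ℂ) *
    (twist (2 * Real.pi * η) z y * F (z + y))) z]
  congr 1
  refine integral_congr_ae (.of_forall fun w => ?_)
  simp only [add_sub_cancel]
  rw [mul_comm (F w), ← mul_assoc]
  congr 1
  simp only [twist, crKernel, Complex.ofReal_exp, ← Complex.exp_add]
  congr 1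
  have e : (nsq (w - z) : ℂ) + 2 * Complex.I * imPair z (w - z) = nsq z + nsq w -
      2 * ∑ j, z j * (starRingEnd ℂ) (w j) := by
    simp only [nsq, imPair, Complex.ofReal_sum, Finset.mul_sum, ← Finset.sum_add_distrib,
      ← Finset.sum_sub_distrib]
    refine Finset.sum_congr rfl fun j _ => ?_
    apply Complex.ext <;> simp [Complex.normSq_apply] <;> ring
  push_cast
  linear_combination (-(2 * (Real.pi : ℂ) * η)) * e

end CRKernel

section Approximation

variable {n : ℕ}

/-- The normalization of the reproducing kernel of CR functions at frequency `η`. -/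
def avgCoeff (n : ℕ) (η : ℝ) : ℂ := (((4 * Real.pi * η) ^ n / gaussMass n 1 : ℝ) : ℂ)

/-- The twisted Gaussian average of the partial Fourier transform of `v`. -/
def spectralAvg (v : Hgrp n → ℂ) (z : Fin n → ℂ) (η : ℝ) : ℂ :=
  avgCoeff n η * ∫ w, tFourier v w η * crKernel (η, w) (z, 0)

theorem spectralAvg_eq (v : Hgrp n → ℂ) (z : Fin n → ℂ) {η : ℝ} (hη : 0 < η) :
    spectralAvg v z η =
      gaussAvg (2 * Real.pi * η) (4 * Real.pi * η) (fun z => tFourier v z η) z := by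
  rw [gaussAvg_eq_integral_crKernel hη]
  rfl

theorem continuous_avgCoeff : Continuous (avgCoeff n) := by
  unfold avgCoeff
  fun_prop

theorem continuous_spectralAvg {v : Hgrp n → ℂ} (hv : Continuous v) (hs : HasCompactSupport v) :
    Continuous fun p : Hgrp n => spectralAvg v p.1 p.2 := by
  obtain ⟨K, T, hK, -, h⟩ := exists_compact_prod hs
  have h1 := continuous_tFourier hv hs
  have h2 := continuous_crKernel (n := n)
  refine (continuous_avgCoeff.comp continuous_snd).mul ?_
  have := continuous_parametric_integral_of_continuous (μ := volume)
    (f := fun (p : Hgrp n) (w : Fin n → ℂ) => tFourier v w p.2 * crKernel (p.2, w) (p.1, 0))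
    ((h1.comp (by fun_prop : Continuous fun x : Hgrp n × (Fin n → ℂ) => ((x.2, x.1.2) : Hgrp n))).mul
      (h2.comp (by fun_prop : Continuous fun x : Hgrp n × (Fin n → ℂ) =>
        (((x.1.2, x.2), (x.1.1, 0)) : (ℝ × (Fin n → ℂ)) × Hgrp n)))) hK
  refine this.congr fun p => setIntegral_eq_integral_of_forall_compl_eq_zero fun w hw => ?_
  rw [tFourier_eq_zero (fun t => h w t (Or.inl hw)), zero_mul]

/-- A CR function approximating `v`, assembled from the frequencies in `(R, M]`. -/
def crApprox (v : Hgrp n → ℂ) (R M : ℝ) (p : Hgrp n) : ℂ :=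
  ∫ q : ℝ × (Fin n → ℂ), avgCoeff n q.1 * tFourier v q.2 q.1 * crKernel q p
    ∂((volume.restrict (Set.Ioc R M)).prod volume)

theorem integrable_avgCoeff_mul_tFourier {v : Hgrp n → ℂ} (hv : Continuous v)
    (hs : HasCompactSupport v) (R M : ℝ) :
    Integrable (fun q : ℝ × (Fin n → ℂ) => avgCoeff n q.1 * tFourier v q.2 q.1)
      ((volume.restrict (Set.Ioc R M)).prod volume) := by
  obtain ⟨K, T, hK, -, h⟩ := exists_compact_prod hs
  have h1 := (continuous_tFourier hv hs).comp
    (by fun_prop : Continuous fun q : ℝ × (Fin n → ℂ) => ((q.2, q.1) : Hgrp n))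
  have hc : Continuous fun q : ℝ × (Fin n → ℂ) => avgCoeff n q.1 * tFourier v q.2 q.1 :=
    (continuous_avgCoeff.comp continuous_fst).mul h1
  have h2 : IntegrableOn (fun q : ℝ × (Fin n → ℂ) => avgCoeff n q.1 * tFourier v q.2 q.1)
      (Set.Icc R M ×ˢ K) (volume.prod volume) :=
    hc.continuousOn.integrableOn_compact (isCompact_Icc.prod hK)
  have e : ((volume.restrict (Set.Ioc R M)).prod volume : Measure (ℝ × (Fin n → ℂ))) =
      (volume.prod volume).restrict (Set.Ioc R M ×ˢ Set.univ) := by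
    rw [← Measure.prod_restrict, Measure.restrict_univ]
  rw [e]
  refine IntegrableOn.of_forall_sdiff_eq_zero (s := Set.Ioc R M ×ˢ K)
    (h2.mono_set (Set.prod_mono Set.Ioc_subset_Icc_self subset_rfl))
    (measurableSet_Ioc.prod MeasurableSet.univ) fun q hq => ?_
  have : q.2 ∉ K := fun hk => hq.2 ⟨hq.1.1, hk⟩
  rw [tFourier_eq_zero (fun t => h q.2 t (Or.inl this)), mul_zero]

theorem ae_fst_mem_Ioc (R M : ℝ) : ∀ᵐ q : ℝ × (Fin n → ℂ)
    ∂((volume.restrict (Set.Ioc R M)).prod volume), q.1 ∈ Set.Ioc R M :=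
  Measure.quasiMeasurePreserving_fst.ae (ae_restrict_mem measurableSet_Ioc)

theorem isCRfun_crApprox {v : Hgrp n → ℂ} (hv : Continuous v) (hs : HasCompactSupport v)
    {R : ℝ} (hR : 0 ≤ R) (M : ℝ) : IsCRfun (crApprox v R M) := by
  refine isCRfun_integral (integrable_avgCoeff_mul_tFourier hv hs R M)
    continuous_crKernel.aestronglyMeasurable ?_ contDiff_crKernel
    (fun q j p => Lbar_crKernel q j p)
  filter_upwards [ae_fst_mem_Ioc R M] with q hq p
  exact norm_crKernel_le_one (hR.trans hq.1.le) p

theorem stronglyMeasurable_crApprox {v : Hgrp n → ℂ} (hv : Continuous v)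
    (hs : HasCompactSupport v) (R M : ℝ) : StronglyMeasurable (crApprox v R M) := by
  have h1 := (continuous_tFourier hv hs).comp
    (by fun_prop : Continuous fun x : Hgrp n × (ℝ × (Fin n → ℂ)) => ((x.2.2, x.2.1) : Hgrp n))
  have h2 := continuous_crKernel.comp
    (continuous_swap : Continuous (Prod.swap : Hgrp n × (ℝ × (Fin n → ℂ)) → _))
  have hc : Continuous fun x : Hgrp n × (ℝ × (Fin n → ℂ)) =>
      avgCoeff n x.2.1 * tFourier v x.2.2 x.2.1 * crKernel x.2 x.1 :=
    ((continuous_avgCoeff.comp (by fun_prop)).mul h1).mul h2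
  exact hc.stronglyMeasurable.integral_prod_right

theorem crKernel_eq_mul_exp (q : ℝ × (Fin n → ℂ)) (z : Fin n → ℂ) (t : ℝ) :
    crKernel q (z, t) =
      Complex.exp (((2 * Real.pi * (q.1 * t) : ℝ) : ℂ) * Complex.I) * crKernel q (z, 0) := by
  rw [crKernel, crKernel, ← Complex.exp_add]
  congr 1
  push_cast
  ring

open FourierTransform in
theorem crApprox_eq_fourierInv {v : Hgrp n → ℂ} (hv : Continuous v) (hs : HasCompactSupport v)
    {R : ℝ} (hR : 0 ≤ R) (M : ℝ) (z : Fin n → ℂ) (t : ℝ) :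
    crApprox v R M (z, t) = 𝓕⁻ ((Set.Ioc R M).indicator (spectralAvg v z)) t := by
  have hint : Integrable (fun q : ℝ × (Fin n → ℂ) =>
      avgCoeff n q.1 * tFourier v q.2 q.1 * crKernel q (z, t))
      ((volume.restrict (Set.Ioc R M)).prod volume) := by
    refine (integrable_avgCoeff_mul_tFourier hv hs R M).mul_bdd (c := 1)
      (continuous_crKernel.comp (by fun_prop : Continuous fun q : ℝ × (Fin n → ℂ) =>
        ((q, (z, t)) : (ℝ × (Fin n → ℂ)) × Hgrp n))).aestronglyMeasurable ?_
    filter_upwards [ae_fst_mem_Ioc R M] with q hq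
    exact norm_crKernel_le_one (hR.trans hq.1.le) _
  rw [crApprox, integral_prod _ hint, Real.fourierInv_eq', ← integral_indicator measurableSet_Ioc]
  refine integral_congr_ae (.of_forall fun η => ?_)
  by_cases hη : η ∈ Set.Ioc R M
  · simp only [Set.indicator_of_mem hη, spectralAvg, crKernel_eq_mul_exp _ z t, smul_eq_mul]
    rw [← integral_const_mul, ← integral_const_mul]
    refine integral_congr_ae (.of_forall fun w => ?_)
    simp
    ring_nf
  · simp only [Set.indicator_of_notMem hη, smul_zero]

theorem memLp_indicator_spectralAvg {v : Hgrp n → ℂ} (hv : Continuous v)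
    (hs : HasCompactSupport v) (R M : ℝ) (z : Fin n → ℂ) (p : ℝ≥0∞) :
    MemLp ((Set.Ioc R M).indicator (spectralAvg v z)) p := by
  have hc : Continuous (spectralAvg v z) := (continuous_spectralAvg hv hs).comp
    (by fun_prop : Continuous fun η : ℝ => ((z, η) : Hgrp n))
  obtain ⟨C, hC⟩ := (isCompact_Icc (a := R) (b := M)).exists_bound_of_continuousOn hc.continuousOn
  rw [memLp_indicator_iff_restrict measurableSet_Ioc]
  refine MemLp.of_bound hc.aestronglyMeasurable C ?_
  filter_upwards [ae_restrict_mem measurableSet_Ioc] with η hη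
  exact hC η (Set.Ioc_subset_Icc_self hη)

theorem memLp_tFourier {v : Hgrp n → ℂ} (hv : Continuous v)
    (hs : HasCompactSupport v) (z : Fin n → ℂ) : MemLp (tFourier v z) 2 := by
  have hc : Continuous (tFourier v z) := (continuous_tFourier hv hs).comp
    (by fun_prop : Continuous fun η : ℝ => ((z, η) : Hgrp n))
  have h2 := ((continuous_slice hv z).memLp_of_hasCompactSupport (p := 2) (μ := volume)
    (hasCompactSupport_slice hs z)).2
  refine ⟨hc.aestronglyMeasurable, ?_⟩
  have h : eLpNorm (tFourier v z) 2 volume ^ 2 < ⊤ := by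
    rw [eLpNorm_two_sq, lintegral_enorm_tFourier_sq hv hs, ← eLpNorm_two_sq]
    exact ENNReal.pow_lt_top h2
  exact (ENNReal.pow_lt_top_iff.1 h).resolve_right (by norm_num)

theorem lintegral_enorm_sub_crApprox_sq {v : Hgrp n → ℂ} (hv : ContDiff ℝ ∞ v)
    (hs : HasCompactSupport v) {R : ℝ} (hR : 0 ≤ R) (M : ℝ) :
    ∫⁻ p, ‖v p - crApprox v R M p‖ₑ ^ 2 =
      ∫⁻ η, ∫⁻ z, ‖tFourier v z η - (Set.Ioc R M).indicator (spectralAvg v z) η‖ₑ ^ 2 := by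
  have hm : Measurable fun p => ‖v p - crApprox v R M p‖ₑ ^ 2 :=
    ((hv.continuous.measurable.sub
      (stronglyMeasurable_crApprox hv.continuous hs R M).measurable).enorm).pow_const 2
  have hA : Measurable fun p : Hgrp n => (Set.Ioc R M).indicator (spectralAvg v p.1) p.2 := by
    have h1 := (continuous_spectralAvg hv.continuous hs).measurable.indicator
      (measurable_snd measurableSet_Ioc : MeasurableSet (Prod.snd ⁻¹' Set.Ioc R M : Set (Hgrp n)))
    exact h1
  have hV := (continuous_tFourier hv.continuous hs).measurable
  rw [lintegral_lintegral_swap, Measure.volume_eq_prod, lintegral_prod _ hm.aemeasurable]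
  · refine lintegral_congr fun z => ?_
    obtain ⟨hi, hinv⟩ := fourierInv_tFourier hv hs z
    have hb1 := memLp_one_iff_integrable.1 (memLp_indicator_spectralAvg hv.continuous hs R M z 1)
    rw [← lintegral_enorm_fourierInv_sq (h := fun η => tFourier v z η -
      (Set.Ioc R M).indicator (spectralAvg v z) η) (hi.sub hb1)
      ((memLp_tFourier hv.continuous hs z).sub
        (memLp_indicator_spectralAvg hv.continuous hs R M z 2))]
    refine lintegral_congr fun t => ?_
    congr 2
    rw [crApprox_eq_fourierInv hv.continuous hs hR, ← hinv t]
    simp only [Real.fourierInv_eq', smul_eq_mul, mul_sub]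
    rw [integral_sub]
    · exact hi.bdd_mul (c := 1) (by fun_prop)
        (.of_forall fun η => (Complex.norm_exp_ofReal_mul_I _).le)
    · exact hb1.bdd_mul (c := 1) (by fun_prop)
        (.of_forall fun η => (Complex.norm_exp_ofReal_mul_I _).le)
  · have h1 : Measurable fun p : Hgrp n => ‖tFourier v p.1 p.2 -
        (Set.Ioc R M).indicator (spectralAvg v p.1) p.2‖ₑ ^ 2 := (hV.sub hA).enorm.pow_const 2
    exact (h1.comp measurable_swap).aemeasurable

end Approximation

section FrequencyDecomposition

variable {n : ℕ}

/-- The sum over `j` of the squared `L²` norms of `Lbar j v`. -/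
def lbarEnergy (v : Hgrp n → ℂ) : ℝ≥0∞ := ∑ j, ∫⁻ p, ‖Lbar j v p‖ₑ ^ 2

/-- The density of `lbarEnergy v` over the frequency `η`. -/
def sliceEnergy (v : Hgrp n → ℂ) (η : ℝ) : ℝ≥0∞ :=
  ∑ j, ∫⁻ z, ‖tFourier (Lbar j v) z η‖ₑ ^ 2

/-- The density of the squared `L²` norm of `v` over the frequency `η`. -/
def sliceMass (v : Hgrp n → ℂ) (η : ℝ) : ℝ≥0∞ := ∫⁻ z, ‖tFourier v z η‖ₑ ^ 2

theorem measurable_sliceMass {v : Hgrp n → ℂ} (hv : Continuous v) (hs : HasCompactSupport v) :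
    Measurable (sliceMass v) := by
  have h1 : Measurable fun p : Hgrp n => ‖tFourier v p.1 p.2‖ₑ ^ 2 :=
    (continuous_tFourier hv hs).measurable.enorm.pow_const 2
  exact h1.lintegral_prod_left'

theorem lintegral_sliceEnergy {v : Hgrp n → ℂ} (hv : ContDiff ℝ 1 v) (hs : HasCompactSupport v) :
    ∫⁻ η, sliceEnergy v η = lbarEnergy v := by
  have h : ∀ j, Measurable fun η => ∫⁻ z, ‖tFourier (Lbar j v) z η‖ₑ ^ 2 := fun j =>
    measurable_sliceMass (continuous_Lbar hv j) (hasCompactSupport_Lbar hs j)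
  unfold sliceEnergy lbarEnergy
  rw [lintegral_finsetSum _ fun j _ => h j]
  exact Finset.sum_congr rfl fun j _ => lintegral_lintegral_enorm_tFourier_sq
    (continuous_Lbar hv j) (hasCompactSupport_Lbar hs j)

theorem measurable_sliceEnergy {v : Hgrp n → ℂ} (hv : ContDiff ℝ 1 v) (hs : HasCompactSupport v) :
    Measurable (sliceEnergy v) :=
  Finset.measurable_fun_sum _ fun j _ =>
    measurable_sliceMass (continuous_Lbar hv j) (hasCompactSupport_Lbar hs j)

theorem lintegral_enorm_sq_lt_top {w : Hgrp n → ℂ} (hw : Continuous w)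
    (hs : HasCompactSupport w) : ∫⁻ p, ‖w p‖ₑ ^ 2 < ⊤ := by
  rw [← eLpNorm_two_sq]
  exact ENNReal.pow_lt_top (hw.memLp_of_hasCompactSupport (p := 2) hs).2

theorem lbarEnergy_lt_top {v : Hgrp n → ℂ} (hv : ContDiff ℝ 1 v) (hs : HasCompactSupport v) :
    lbarEnergy v < ⊤ :=
  ENNReal.sum_lt_top.2 fun j _ =>
    lintegral_enorm_sq_lt_top (continuous_Lbar hv j) (hasCompactSupport_Lbar hs j)

theorem sum_twistedDbar_tFourier {v : Hgrp n → ℂ} (hv : ContDiff ℝ 1 v)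
    (hs : HasCompactSupport v) (η : ℝ) :
    ∑ j, ∫⁻ z, ‖twistedDbar (2 * Real.pi * η) j (fun z => tFourier v z η) z‖ₑ ^ 2 =
      sliceEnergy v η := by
  simp only [twistedDbar_tFourier hv hs, sliceEnergy]

theorem lintegral_sub_gaussAvg_tFourier_le {v : Hgrp n → ℂ} (hv : ContDiff ℝ 1 v)
    (hs : HasCompactSupport v) {η κ : ℝ} (hκ : 0 < κ) (h : 2 * (2 * Real.pi * η) ≤ κ) :
    ∫⁻ z, ‖tFourier v z η - gaussAvg (2 * Real.pi * η) κ (fun z => tFourier v z η) z‖ₑ ^ 2 ≤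
      ENNReal.ofReal (sliceConst n / κ) * (n * sliceEnergy v η) := by
  rw [← sum_twistedDbar_tFourier hv hs]
  exact lintegral_enorm_sub_gaussAvg_sq_le (contDiff_tFourier hv hs η)
    (hasCompactSupport_tFourier hs η) hκ h

theorem lintegral_sub_indicator_spectralAvg_le [NeZero n] {v : Hgrp n → ℂ} (hv : ContDiff ℝ 1 v)
    (hs : HasCompactSupport v) {R : ℝ} (hR : 0 < R) (M η : ℝ) :
    ∫⁻ z, ‖tFourier v z η - (Set.Ioc R M).indicator (spectralAvg v z) η‖ₑ ^ 2 ≤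
      ENNReal.ofReal (sliceConst n / R) * (n * sliceEnergy v η) +
        (Set.Icc (-R) R).indicator (sliceMass v) η + (Set.Ioi M).indicator (sliceMass v) η := by
  have hpi := Real.pi_gt_three
  have hC : 0 ≤ sliceConst n := sliceConst_nonneg
  by_cases h1 : η ∈ Set.Ioc R M
  · have hη : 0 < η := hR.trans h1.1
    have hRη : R * 1 ≤ η * (4 * Real.pi) := mul_le_mul h1.1.le (by linarith) one_pos.le hη.le
    simp only [Set.indicator_of_mem h1, spectralAvg_eq v _ hη]
    refine (lintegral_sub_gaussAvg_tFourier_le hv hs (by positivity)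
      (by linarith [mul_assoc 2 Real.pi η])).trans ?_
    refine le_trans ?_ (le_self_add.trans le_self_add)
    gcongr
    linarith
  · simp only [Set.indicator_of_notMem h1, sub_zero]
    change sliceMass v η ≤ _
    by_cases h2 : η ∈ Set.Icc (-R) R
    · rw [Set.indicator_of_mem h2]
      exact le_add_self.trans le_self_add
    · by_cases h3 : η ∈ Set.Ioi M
      · rw [Set.indicator_of_mem h3 (sliceMass v)]
        exact le_add_self
      · have h4 : η < -R := by
          simp only [Set.mem_Ioc, Set.mem_Icc, Set.mem_Ioi, not_and, not_le, not_lt] at h1 h2 h3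
          by_contra! h
          exact (h1 (h2 h)).not_ge h3
        have hη : η < 0 := by linarith
        refine (lintegral_enorm_sq_le_of_neg (contDiff_tFourier hv hs η)
          (hasCompactSupport_tFourier hs η) (ξ := 2 * Real.pi * η)
          (mul_neg_of_pos_of_neg (by positivity) hη)).trans ?_
        rw [sum_twistedDbar_tFourier hv hs, ← mul_assoc]
        refine le_trans ?_ (le_self_add.trans le_self_add)
        gcongr
        rw [← ENNReal.ofReal_ofNat 4, ← ENNReal.ofReal_mul (by norm_num)]
        refine ENNReal.ofReal_le_ofReal ?_
        have h5 : R * 4 ≤ (-η) * (2 * Real.pi) :=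
          mul_le_mul (by linarith) (by linarith) (by norm_num) (by linarith)
        rw [mul_div_assoc', div_le_div_iff₀ (by nlinarith) hR]
        nlinarith [mul_le_mul_of_nonneg_left h5 hC]

theorem exists_setLIntegral_sliceMass_le {v : Hgrp n → ℂ} (hv : Continuous v)
    (hs : HasCompactSupport v) {δ : ℝ≥0∞} (hδ : δ ≠ 0) :
    ∃ M : ℝ, ∫⁻ η, (Set.Ioi M).indicator (sliceMass v) η ≤ δ := by
  have hm := measurable_sliceMass hv hs
  have h := tendsto_lintegral_of_dominated_convergence (μ := volume)
    (F := fun (k : ℕ) η => (Set.Ioi (k : ℝ)).indicator (sliceMass v) η) (f := fun _ => 0)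
    (sliceMass v) (fun k => hm.indicator measurableSet_Ioi)
    (fun k => .of_forall fun η => Set.indicator_le_self _ _ _)
    (by
      have := lintegral_enorm_sq_lt_top hv hs
      rw [← lintegral_lintegral_enorm_tFourier_sq hv hs] at this
      exact this.ne)
    (.of_forall fun η => by
      refine tendsto_const_nhds.congr' ?_
      filter_upwards [eventually_ge_atTop ⌈η⌉₊] with k hk
      rw [Set.indicator_of_notMem]
      simpa using Nat.ceil_le.1 hk)
  rw [lintegral_zero] at h
  obtain ⟨k, hk⟩ := (h.eventually_le_const (pos_iff_ne_zero.2 hδ)).exists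
  exact ⟨k, hk⟩

/-- A compactly supported smooth function is approximated by a CR function up to its `Lbar`
energy, with a small factor, and its low frequencies. -/
theorem exists_isCRfun_approx [NeZero n] {v : Hgrp n → ℂ} (hv : ContDiff ℝ ∞ v)
    (hs : HasCompactSupport v) {R : ℝ} (hR : 0 < R) {δ : ℝ≥0∞} (hδ : δ ≠ 0) :
    ∃ g : Hgrp n → ℂ, IsCRfun g ∧ MemLp g 2 ∧
      ∫⁻ p, ‖v p - g p‖ₑ ^ 2 ≤ ENNReal.ofReal (sliceConst n / R) * (n * lbarEnergy v) +
        (∫⁻ η in Set.Icc (-R) R, sliceMass v η) + δ := by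
  have hv1 : ContDiff ℝ 1 v := hv.of_le (by norm_cast)
  have hm := measurable_sliceMass hv.continuous hs
  wlog hδ' : δ < ⊤ generalizing δ
  · obtain ⟨g, h1, h2, h3⟩ := this (δ := 1) one_ne_zero ENNReal.one_lt_top
    refine ⟨g, h1, h2, ?_⟩
    rw [not_lt_top_iff.1 hδ', add_top]
    exact le_top
  obtain ⟨M, hM⟩ := exists_setLIntegral_sliceMass_le hv.continuous hs hδ
  have hbound : ∫⁻ p, ‖v p - crApprox v R M p‖ₑ ^ 2 ≤
      ENNReal.ofReal (sliceConst n / R) * (n * lbarEnergy v) +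
        (∫⁻ η in Set.Icc (-R) R, sliceMass v η) + δ := by
    rw [lintegral_enorm_sub_crApprox_sq hv hs hR.le]
    refine (lintegral_mono fun η =>
      lintegral_sub_indicator_spectralAvg_le hv1 hs hR M η).trans ?_
    rw [lintegral_add_right _ (hm.indicator measurableSet_Ioi),
      lintegral_add_right _ (hm.indicator measurableSet_Icc),
      lintegral_const_mul _ ((measurable_sliceEnergy hv1 hs).const_mul _),
      lintegral_const_mul _ (measurable_sliceEnergy hv1 hs), lintegral_sliceEnergy hv1 hs,
      lintegral_indicator measurableSet_Icc]
    gcongr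
  refine ⟨crApprox v R M, isCRfun_crApprox hv.continuous hs hR.le M, ?_, hbound⟩
  have hlow : ∫⁻ η in Set.Icc (-R) R, sliceMass v η < ⊤ := by
    refine (setLIntegral_le_lintegral _ _).trans_lt ?_
    have := lintegral_enorm_sq_lt_top hv.continuous hs
    rwa [← lintegral_lintegral_enorm_tFourier_sq hv.continuous hs] at this
  have hsub : MemLp (fun p => v p - crApprox v R M p) 2 := by
    refine ⟨(hv.continuous.stronglyMeasurable.sub
      (stronglyMeasurable_crApprox hv.continuous hs R M)).aestronglyMeasurable, ?_⟩
    have h : eLpNorm (fun p => v p - crApprox v R M p) 2 volume ^ 2 < ⊤ := by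
      rw [eLpNorm_two_sq]
      refine hbound.trans_lt (ENNReal.add_lt_top.2 ⟨ENNReal.add_lt_top.2 ⟨?_, hlow⟩, hδ'⟩)
      exact ENNReal.mul_lt_top ENNReal.ofReal_lt_top
        (ENNReal.mul_lt_top (ENNReal.natCast_lt_top n) (lbarEnergy_lt_top hv1 hs))
    exact (ENNReal.pow_lt_top_iff.1 h).resolve_right (by norm_num)
  have := (hv.continuous.memLp_of_hasCompactSupport (p := 2) (μ := volume) hs).sub hsub
  rwa [show (v - fun p => v p - crApprox v R M p) = crApprox v R M by ext p; simp] at this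

end FrequencyDecomposition

section LowFrequencies

variable {n : ℕ}

/-- The kernel of the twisted Gaussian average of the partial Fourier transform. -/
@[irreducible] def lowKernel (κ : ℝ) (q p : Hgrp n) : ℂ :=
  (((∫ y : Fin n → ℂ, Real.exp (-κ * nsq y) : ℝ) : ℂ))⁻¹ *
    ((Real.exp (-κ * nsq (p.1 - q.1)) : ℂ) * (twist (2 * Real.pi * q.2) q.1 (p.1 - q.1) *
      Complex.exp (((-2 * Real.pi * p.2 * q.2 : ℝ) : ℂ) * Complex.I)))

theorem continuous_lowKernel (κ : ℝ) :
    Continuous fun x : Hgrp n × Hgrp n => lowKernel κ x.1 x.2 := by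
  have h := continuous_nsq (n := n)
  unfold lowKernel twist imPair
  fun_prop

theorem continuous_lowKernel_right (κ : ℝ) (q : Hgrp n) : Continuous (lowKernel κ q) :=
  Continuous.comp (g := fun x : Hgrp n × Hgrp n => lowKernel κ x.1 x.2)
    (continuous_lowKernel κ) (by fun_prop : Continuous fun p : Hgrp n => (q, p))

theorem integrable_lowKernel_mul {v : Hgrp n → ℂ} (hv : Continuous v) (hs : HasCompactSupport v)
    (κ : ℝ) (q : Hgrp n) : Integrable fun p => lowKernel κ q p * v p := by
  have hc := continuous_lowKernel_right κ q
  generalize lowKernel κ q = g at hc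
  exact (hc.mul hv).integrable_of_hasCompactSupport hs.mul_left

theorem gaussAvg_tFourier_eq {v : Hgrp n → ℂ} (hv : Continuous v) (hs : HasCompactSupport v)
    (κ : ℝ) (q : Hgrp n) :
    gaussAvg (2 * Real.pi * q.2) κ (fun z => tFourier v z q.2) q.1 =
      ∫ p, lowKernel κ q p * v p := by
  have hi := integrable_lowKernel_mul hv hs κ q
  rw [Measure.volume_eq_prod, integral_prod _ hi, gaussAvg,
    ← integral_const_mul, ← integral_sub_right_eq_self _ q.1]
  refine integral_congr_ae (.of_forall fun w => ?_)
  simp only [tFourier, lowKernel, add_sub_cancel]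
  simp only [← integral_const_mul]
  refine integral_congr_ae (.of_forall fun t => ?_)
  ring

theorem setLIntegral_sliceMass_le {v : Hgrp n → ℂ} (hv : ContDiff ℝ 1 v)
    (hs : HasCompactSupport v) {Z : Set (Fin n → ℂ)} (hZm : MeasurableSet Z)
    (hZ : ∀ z t, z ∉ Z → v (z, t) = 0) {R : ℝ} (hR : 0 < R) :
    ∫⁻ η in Set.Icc (-R) R, sliceMass v η ≤
      2 * (ENNReal.ofReal (sliceConst n / R) * (n * lbarEnergy v)) +
        2 * ∫⁻ q in Z ×ˢ Set.Icc (-R) R, ‖∫ p, lowKernel (16 * R) q p * v p‖ₑ ^ 2 := by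
  have hpi := Real.pi_lt_four
  have hC : 0 ≤ sliceConst n := sliceConst_nonneg
  set G : Hgrp n → ℂ := fun q => ∫ p, lowKernel (16 * R) q p * v p with hG
  have hGm : Measurable fun q => ‖G q‖ₑ ^ 2 := by
    refine StronglyMeasurable.enorm ?_ |>.pow_const 2
    exact ((continuous_lowKernel (16 * R)).mul
      (hv.continuous.comp continuous_snd)).stronglyMeasurable.integral_prod_right
  have hGs : Measurable fun η => ∫⁻ z in Z, ‖G (z, η)‖ₑ ^ 2 := hGm.lintegral_prod_left'
  have hslice : ∀ η ∈ Set.Icc (-R) R, sliceMass v η ≤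
      2 * (ENNReal.ofReal (sliceConst n / R) * (n * sliceEnergy v η)) +
        2 * ∫⁻ z in Z, ‖G (z, η)‖ₑ ^ 2 := by
    intro η hη
    have hV : Measurable fun z => tFourier v z η :=
      (contDiff_tFourier hv hs η).continuous.measurable
    have hsupp : ∀ z, ‖tFourier v z η‖ₑ ^ 2 = Z.indicator (fun z => ‖tFourier v z η‖ₑ ^ 2) z := by
      intro z
      by_cases hz : z ∈ Z
      · rw [Set.indicator_of_mem hz]
      · rw [Set.indicator_of_notMem hz, tFourier_eq_zero fun t => hZ z t hz]
        simp
    have hGη : Measurable fun z => ‖G (z, η)‖ₑ ^ 2 :=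
      hGm.comp (by fun_prop : Measurable fun z : Fin n → ℂ => ((z, η) : Hgrp n))
    calc sliceMass v η = ∫⁻ z in Z, ‖tFourier v z η‖ₑ ^ 2 := by
          rw [sliceMass, lintegral_congr hsupp, lintegral_indicator hZm]
      _ ≤ ∫⁻ z in Z, (2 * ‖tFourier v z η - G (z, η)‖ₑ ^ 2 + 2 * ‖G (z, η)‖ₑ ^ 2) := by
          refine lintegral_mono fun z => ?_
          rw [← mul_add]
          refine le_trans ?_ (add_sq_le_ennreal _ _)
          gcongr
          simpa using enorm_add_le (tFourier v z η - G (z, η)) (G (z, η))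
      _ = 2 * (∫⁻ z in Z, ‖tFourier v z η - G (z, η)‖ₑ ^ 2) +
            2 * ∫⁻ z in Z, ‖G (z, η)‖ₑ ^ 2 := by
          rw [lintegral_add_right _ (hGη.const_mul 2), lintegral_const_mul' _ _ (by simp),
            lintegral_const_mul _ hGη]
      _ ≤ _ := by
          gcongr
          refine (setLIntegral_le_lintegral _ _).trans ?_
          simp only [hG, ← gaussAvg_tFourier_eq hv.continuous hs]
          refine (lintegral_sub_gaussAvg_tFourier_le hv hs (by positivity) ?_).trans ?_
          · have : Real.pi * η ≤ 4 * R :=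
              (mul_le_mul_of_nonneg_left hη.2 Real.pi_pos.le).trans (by gcongr)
            linarith [mul_assoc 2 Real.pi η]
          · gcongr
            linarith
  calc ∫⁻ η in Set.Icc (-R) R, sliceMass v η
      ≤ ∫⁻ η in Set.Icc (-R) R, (2 * (ENNReal.ofReal (sliceConst n / R) *
          (n * sliceEnergy v η)) + 2 * ∫⁻ z in Z, ‖G (z, η)‖ₑ ^ 2) :=
        setLIntegral_mono' measurableSet_Icc hslice
    _ = 2 * (ENNReal.ofReal (sliceConst n / R) * (n * ∫⁻ η in Set.Icc (-R) R, sliceEnergy v η)) +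
          2 * ∫⁻ η in Set.Icc (-R) R, ∫⁻ z in Z, ‖G (z, η)‖ₑ ^ 2 := by
        have hE := measurable_sliceEnergy hv hs
        rw [lintegral_add_right _ (hGs.const_mul 2), lintegral_const_mul _ hGs,
          lintegral_const_mul _ ((hE.const_mul _).const_mul _),
          lintegral_const_mul _ (hE.const_mul _), lintegral_const_mul _ hE]
    _ ≤ _ := by
        gcongr
        · exact (setLIntegral_le_lintegral _ _).trans (lintegral_sliceEnergy hv hs).le
        · change _ ≤ ∫⁻ q in Z ×ˢ Set.Icc (-R) R, ‖G q‖ₑ ^ 2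
          rw [Measure.volume_eq_prod, ← Measure.prod_restrict,
            lintegral_prod_symm _ hGm.aemeasurable]

theorem integrable_norm_sq {f : Hgrp n → ℂ} (hf : Continuous f) (hs : HasCompactSupport f) :
    Integrable fun p => ‖f p‖ ^ 2 :=
  (memLp_two_iff_integrable_sq_norm hf.aestronglyMeasurable).1
    (hf.memLp_of_hasCompactSupport hs)

theorem norm_integral_mul_le_of_bound {g f : Hgrp n → ℂ} (hf : Continuous f)
    (hs : HasCompactSupport f) {Q : Set (Hgrp n)} (hQ : IsCompact Q) (hfQ : ∀ p ∉ Q, f p = 0)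
    (hbd : ∫ p, ‖f p‖ ^ 2 ≤ 1) {C : ℝ} (hC : ∀ p ∈ Q, ‖g p‖ ≤ C) :
    ‖∫ p, g p * f p‖ ≤ |C| * (volume.real Q + 1) := by
  have hsq := integrable_norm_sq hf hs
  have e : ∫ p, g p * f p = ∫ p in Q, g p * f p :=
    (setIntegral_eq_integral_of_forall_compl_eq_zero fun p hp => by
      rw [hfQ p hp, mul_zero]).symm
  have h1 : IntegrableOn (fun _ : Hgrp n => (1 : ℝ)) Q := integrableOn_const hQ.measure_lt_top.ne
  calc ‖∫ p, g p * f p‖ ≤ ∫ p in Q, |C| * (1 + ‖f p‖ ^ 2) := by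
        rw [e]
        refine norm_integral_le_of_norm_le ((h1.add hsq.integrableOn).const_mul |C|) ?_
        filter_upwards [ae_restrict_mem hQ.measurableSet] with p hp
        rw [norm_mul]
        gcongr
        · exact (hC p hp).trans (le_abs_self C)
        · nlinarith [sq_nonneg (‖f p‖ - 1)]
    _ = |C| * (volume.real Q + ∫ p in Q, ‖f p‖ ^ 2) := by
        rw [integral_const_mul, integral_add h1 hsq.integrableOn]
        simp
    _ ≤ |C| * (volume.real Q + 1) := by
        gcongr
        exact (setIntegral_le_integral hsq (.of_forall fun p => by positivity)).trans hbd

theorem tendsto_integral_mul_of_weak {f : ℕ → Hgrp n → ℂ} {Q : Set (Hgrp n)} (hQ : IsCompact Q)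
    (hfQ : ∀ k, ∀ p ∉ Q, f k p = 0)
    (hweak : ∀ h : Hgrp n → ℂ, MemLp h 2 →
      ∃ c, Tendsto (fun k => ∫ p, h p * f k p) atTop (𝓝 c))
    {g : Hgrp n → ℂ} (hg : Continuous g) :
    ∃ c, Tendsto (fun k => ∫ p, g p * f k p) atTop (𝓝 c) := by
  have hmem : MemLp (Q.indicator g) 2 := by
    rw [memLp_indicator_iff_restrict hQ.measurableSet]
    obtain ⟨C, hC⟩ := hQ.exists_bound_of_continuousOn hg.continuousOn
    have : IsFiniteMeasure (volume.restrict Q) := ⟨by simpa using hQ.measure_lt_top⟩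
    refine MemLp.of_bound hg.aestronglyMeasurable C ?_
    filter_upwards [ae_restrict_mem hQ.measurableSet] with p hp
    exact hC p hp
  obtain ⟨c, hc⟩ := hweak _ hmem
  refine ⟨c, hc.congr fun k => integral_congr_ae (.of_forall fun p => ?_)⟩
  by_cases hp : p ∈ Q
  · simp only [Set.indicator_of_mem hp]
  · simp only [hfQ k p hp, mul_zero]

/-- Weakly convergent sequences with uniformly bounded supports have low frequencies which are
Cauchy. -/
theorem tendsto_setLIntegral_lowKernel {f : ℕ → Hgrp n → ℂ} (hf : ∀ k, Continuous (f k))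
    (hs : ∀ k, HasCompactSupport (f k)) {Q : Set (Hgrp n)} (hQ : IsCompact Q)
    (hfQ : ∀ k, ∀ p ∉ Q, f k p = 0) (hbd : ∀ k, ∫ p, ‖f k p‖ ^ 2 ≤ 1)
    (hweak : ∀ h : Hgrp n → ℂ, MemLp h 2 →
      ∃ c, Tendsto (fun k => ∫ p, h p * f k p) atTop (𝓝 c))
    (κ : ℝ) {P : Set (Hgrp n)} (hP : IsCompact P) :
    Tendsto (fun i : ℕ × ℕ => ∫⁻ q in P, ‖∫ p, lowKernel κ q p * (f i.1 p - f i.2 p)‖ₑ ^ 2)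
      (atTop ×ˢ atTop) (𝓝 0) := by
  have hi : ∀ q k, Integrable fun p => lowKernel κ q p * f k p := fun q k =>
    integrable_lowKernel_mul (hf k) (hs k) κ q
  obtain ⟨C, hC⟩ := (hP.prod hQ).exists_bound_of_continuousOn
    (continuous_lowKernel (n := n) κ).continuousOn
  set D : ℝ := |C| * (volume.real Q + 1) with hD
  have hbound : ∀ q ∈ P, ∀ k, ‖∫ p, lowKernel κ q p * f k p‖ ≤ D := fun q hq k =>
    norm_integral_mul_le_of_bound (hf k) (hs k) hQ (hfQ k) (hbd k) fun p hp =>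
      hC (q, p) ⟨hq, hp⟩
  have hlim : ∀ q, Tendsto (fun i : ℕ × ℕ => ∫ p, lowKernel κ q p * (f i.1 p - f i.2 p))
      (atTop ×ˢ atTop) (𝓝 0) := by
    intro q
    obtain ⟨c, hc⟩ := tendsto_integral_mul_of_weak hQ hfQ hweak (continuous_lowKernel_right κ q)
    have := (hc.comp tendsto_fst).sub (hc.comp (tendsto_snd (f := (atTop : Filter ℕ))))
    rw [sub_self] at this
    refine this.congr fun i => ?_
    simp only [Function.comp, mul_sub]
    rw [integral_sub (hi q i.1) (hi q i.2)]
  have := tendsto_lintegral_filter_of_dominated_convergence (μ := volume.restrict P)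
    (l := (atTop ×ˢ atTop : Filter (ℕ × ℕ)))
    (F := fun i q => ‖∫ p, lowKernel κ q p * (f i.1 p - f i.2 p)‖ₑ ^ 2) (f := fun _ => 0)
    (fun _ => ENNReal.ofReal (D + D) ^ 2) (.of_forall fun i => ?_) (.of_forall fun i => ?_) ?_
    (.of_forall fun q => ?_)
  · simpa using this
  · refine StronglyMeasurable.enorm ?_ |>.pow_const 2
    exact ((continuous_lowKernel κ).mul
      (((hf i.1).sub (hf i.2)).comp continuous_snd)).stronglyMeasurable.integral_prod_right
  · filter_upwards [ae_restrict_mem hP.measurableSet] with q hq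
    gcongr
    rw [← ofReal_norm]
    refine ENNReal.ofReal_le_ofReal ?_
    simp only [mul_sub]
    rw [integral_sub (hi q i.1) (hi q i.2)]
    exact (norm_sub_le _ _).trans (add_le_add (hbound q hq _) (hbound q hq _))
  · rw [setLIntegral_const]
    exact (ENNReal.mul_lt_top (ENNReal.pow_lt_top ENNReal.ofReal_lt_top) hP.measure_lt_top).ne
  · have := ENNReal.Tendsto.pow (n := 2) (hlim q).enorm
    simpa using this

end LowFrequencies

theorem exists_subseq_tendsto_inner {H : Type*} [NormedAddCommGroup H] [InnerProductSpace ℂ H]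
    [CompleteSpace H] [TopologicalSpace.SeparableSpace H] {x : ℕ → H} {r : ℝ}
    (hx : ∀ k, ‖x k‖ ≤ r) :
    ∃ φ : ℕ → ℕ, StrictMono φ ∧
      ∀ y, ∃ c, Tendsto (fun k => inner ℂ (x (φ k)) y) atTop (𝓝 c) := by
  obtain ⟨a, -, φ, hφ, ha⟩ := WeakDual.isSeqCompact_closedBall ℂ H 0 r
    (x := fun k => StrongDual.toWeakDual (InnerProductSpace.toDual ℂ H (x k)))
    (fun k => by simpa using hx k)
  refine ⟨φ, hφ, fun y => ⟨a y, ?_⟩⟩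
  exact ((WeakDual.eval_continuous y).tendsto a).comp ha

section Projection

variable {n : ℕ}

theorem exists_subseq_tendsto_integral {f : ℕ → Hgrp n → ℂ}
    {fL : ℕ → Lp ℂ 2 (volume : Measure (Hgrp n))} (hfL : ∀ k, ⇑(fL k) =ᵐ[volume] f k) {r : ℝ}
    (hr : ∀ k, ‖fL k‖ ≤ r) :
    ∃ φ : ℕ → ℕ, StrictMono φ ∧ ∀ h : Hgrp n → ℂ, MemLp h 2 →
      ∃ c, Tendsto (fun k => ∫ p, h p * f (φ k) p) atTop (𝓝 c) := by
  have : Fact ((2 : ℝ≥0∞) ≠ ⊤) := ⟨by norm_num⟩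
  obtain ⟨φ, hφ, hlim⟩ := exists_subseq_tendsto_inner hr
  refine ⟨φ, hφ, fun h hh => ?_⟩
  obtain ⟨c, hc⟩ := hlim hh.star.toLp
  refine ⟨starRingEnd ℂ c, ((continuous_conj.tendsto c).comp hc).congr fun k => ?_⟩
  rw [Function.comp, L2.inner_def, ← integral_conj]
  refine integral_congr_ae ?_
  filter_upwards [hfL (φ k), hh.star.coeFn_toLp] with p h1 h2
  simp [h1, h2, mul_comm]

theorem IsCRfun.congr_ae {f g : Hgrp n → ℂ} (hf : IsCRfun f) (h : g =ᵐ[volume] f) :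
    IsCRfun g := by
  intro j φ hφ hs
  rw [← hf j φ hφ hs]
  refine integral_congr_ae ?_
  filter_upwards [h] with p hp
  rw [hp]

variable {S : Lp ℂ 2 (volume : Measure (Hgrp n)) →L[ℂ] Lp ℂ 2 (volume : Measure (Hgrp n))}

theorem norm_sub_projection_le (hSmem : ∀ f, IsCRfun (⇑(S f)))
    (hSorth : ∀ (f g : Lp ℂ 2 (volume : Measure (Hgrp n))), IsCRfun (⇑g) →
      inner (𝕜 := ℂ) (f - S f) g = 0)
    (v g : Lp ℂ 2 (volume : Measure (Hgrp n))) (hg : IsCRfun ⇑g) :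
    ‖v - S v‖ ≤ ‖v - g‖ := by
  have h : inner ℂ (v - S v) (v - S v) = inner ℂ (v - S v) (v - g) := by
    rw [inner_sub_right _ v (S v), inner_sub_right _ v g, hSorth v g hg, hSorth v _ (hSmem v)]
  have h2 : ‖v - S v‖ * ‖v - S v‖ ≤ ‖v - S v‖ * ‖v - g‖ := by
    have e : ‖inner ℂ (v - S v) (v - S v)‖ = ‖v - S v‖ * ‖v - S v‖ := by
      rw [inner_self_eq_norm_sq_to_K]
      simp [sq]
    rw [← e, h]
    exact norm_inner_le_norm _ _
  rcases (norm_nonneg (v - S v)).eq_or_lt with h0 | h0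
  · rw [← h0]
    exact norm_nonneg _
  · exact le_of_mul_le_mul_left h2 h0

theorem enorm_sub_projection_sq_le [NeZero n] (hSmem : ∀ f, IsCRfun (⇑(S f)))
    (hSorth : ∀ (f g : Lp ℂ 2 (volume : Measure (Hgrp n))), IsCRfun (⇑g) →
      inner (𝕜 := ℂ) (f - S f) g = 0)
    {v : Hgrp n → ℂ} (hv : ContDiff ℝ ∞ v) (hs : HasCompactSupport v)
    {vL : Lp ℂ 2 (volume : Measure (Hgrp n))} (hvL : ⇑vL =ᵐ[volume] v)
    {Z : Set (Fin n → ℂ)} (hZm : MeasurableSet Z) (hZ : ∀ z t, z ∉ Z → v (z, t) = 0)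
    {R : ℝ} (hR : 0 < R) :
    ‖vL - S vL‖ₑ ^ 2 ≤ 3 * (ENNReal.ofReal (sliceConst n / R) * (n * lbarEnergy v)) +
      2 * ∫⁻ q in Z ×ˢ Set.Icc (-R) R, ‖∫ p, lowKernel (16 * R) q p * v p‖ₑ ^ 2 := by
  refine ENNReal.le_of_forall_pos_le_add fun δ hδ _ => ?_
  obtain ⟨g, hg, hg2, hle⟩ := exists_isCRfun_approx hv hs hR (δ := δ) (by simpa using hδ.ne')
  have h1 : ‖vL - S vL‖ₑ ≤ ‖vL - hg2.toLp‖ₑ :=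
    enorm_le_iff_norm_le.2 (norm_sub_projection_le hSmem hSorth _ _
      (hg.congr_ae hg2.coeFn_toLp))
  have h2 : ‖vL - hg2.toLp‖ₑ ^ 2 = ∫⁻ p, ‖v p - g p‖ₑ ^ 2 := by
    rw [Lp.enorm_def, eLpNorm_two_sq]
    refine lintegral_congr_ae ?_
    filter_upwards [hvL, hg2.coeFn_toLp, Lp.coeFn_sub vL hg2.toLp] with p e1 e2 e3
    rw [e3, Pi.sub_apply, e1, e2]
  calc ‖vL - S vL‖ₑ ^ 2 ≤ ‖vL - hg2.toLp‖ₑ ^ 2 := by gcongr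
    _ ≤ ENNReal.ofReal (sliceConst n / R) * (n * lbarEnergy v) +
        (∫⁻ η in Set.Icc (-R) R, sliceMass v η) + δ := h2.trans_le hle
    _ ≤ ENNReal.ofReal (sliceConst n / R) * (n * lbarEnergy v) +
        (2 * (ENNReal.ofReal (sliceConst n / R) * (n * lbarEnergy v)) +
          2 * ∫⁻ q in Z ×ˢ Set.Icc (-R) R, ‖∫ p, lowKernel (16 * R) q p * v p‖ₑ ^ 2) + δ := by
        gcongr
        exact setLIntegral_sliceMass_le (hv.of_le (by norm_cast)) hs hZm hZ hR
    _ = _ := by ring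

theorem lintegral_enorm_sq_eq_ofReal {w : Hgrp n → ℂ} (hw : Continuous w)
    (hs : HasCompactSupport w) : ∫⁻ p, ‖w p‖ₑ ^ 2 = ENNReal.ofReal (∫ p, ‖w p‖ ^ 2) := by
  rw [ofReal_integral_eq_lintegral_ofReal (integrable_norm_sq hw hs)
    (.of_forall fun p => by positivity)]
  refine lintegral_congr fun p => ?_
  rw [ENNReal.ofReal_pow (norm_nonneg _), ofReal_norm]

theorem lbarEnergy_eq_ofReal {v : Hgrp n → ℂ} (hv : ContDiff ℝ 1 v) (hs : HasCompactSupport v) :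
    lbarEnergy v = ENNReal.ofReal (∑ j, ∫ p, ‖Lbar j v p‖ ^ 2) := by
  rw [ENNReal.ofReal_sum_of_nonneg fun j _ => integral_nonneg fun p => by positivity]
  exact Finset.sum_congr rfl fun j _ =>
    lintegral_enorm_sq_eq_ofReal (continuous_Lbar hv j) (hasCompactSupport_Lbar hs j)

theorem Lbar_sub {f g : Hgrp n → ℂ} (hf : Differentiable ℝ f) (hg : Differentiable ℝ g)
    (j : Fin n) (p : Hgrp n) :
    Lbar j (fun p => f p - g p) p = Lbar j f p - Lbar j g p := by
  simp only [Lbar, dZbar, dT, fderiv_fun_sub (hf p) (hg p), sub_apply]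
  ring

theorem lbarEnergy_sub_le {f g : Hgrp n → ℂ} (hf : ContDiff ℝ 1 f) (hg : ContDiff ℝ 1 g) :
    lbarEnergy (fun p => f p - g p) ≤ 2 * (lbarEnergy f + lbarEnergy g) := by
  unfold lbarEnergy
  rw [← Finset.sum_add_distrib, Finset.mul_sum]
  refine Finset.sum_le_sum fun j _ => ?_
  rw [← lintegral_add_left ((continuous_Lbar hf j).measurable.enorm.pow_const 2),
    ← lintegral_const_mul' _ _ (by simp)]
  refine lintegral_mono fun p => le_trans ?_ (add_sq_le_ennreal _ _)
  rw [Lbar_sub (hf.differentiable one_ne_zero) (hg.differentiable one_ne_zero)]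
  gcongr
  exact enorm_sub_le

theorem cauchySeq_sub_projection [NeZero n] (hSmem : ∀ f, IsCRfun (⇑(S f)))
    (hSorth : ∀ (f g : Lp ℂ 2 (volume : Measure (Hgrp n))), IsCRfun (⇑g) →
      inner (𝕜 := ℂ) (f - S f) g = 0)
    {f : ℕ → Hgrp n → ℂ} (hf : ∀ k, ContDiff ℝ ∞ (f k)) (hs : ∀ k, HasCompactSupport (f k))
    {Q : Set (Hgrp n)} (hQ : IsCompact Q) (hfQ : ∀ k, ∀ p ∉ Q, f k p = 0)
    {fL : ℕ → Lp ℂ 2 (volume : Measure (Hgrp n))} (hfL : ∀ k, ⇑(fL k) =ᵐ[volume] f k)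
    (hbd : ∀ k, ∫ p, ‖f k p‖ ^ 2 ≤ 1) (hen : ∀ k, lbarEnergy (f k) ≤ 1)
    (hweak : ∀ h : Hgrp n → ℂ, MemLp h 2 →
      ∃ c, Tendsto (fun k => ∫ p, h p * f k p) atTop (𝓝 c)) :
    CauchySeq fun k => fL k - S (fL k) := by
  have hf1 : ∀ k, ContDiff ℝ 1 (f k) := fun k => (hf k).of_le (by norm_cast)
  have hZc : IsCompact (Prod.fst '' Q) := hQ.image continuous_fst
  rw [EMetric.cauchySeq_iff]
  intro ε hε
  have hlimR : Tendsto (fun R : ℝ => 3 * (ENNReal.ofReal (sliceConst n / R) * (n * 4)))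
      atTop (𝓝 0) := by
    have h1 : Tendsto (fun R : ℝ => ENNReal.ofReal (sliceConst n / R)) atTop (𝓝 0) := by
      simpa using ENNReal.tendsto_ofReal (tendsto_const_nhds.div_atTop tendsto_id)
    have h2 := ENNReal.Tendsto.const_mul (a := 3) (ENNReal.Tendsto.mul_const (b := n * 4) h1
      (.inr (ENNReal.mul_ne_top (ENNReal.natCast_ne_top n) (by norm_num)))) (.inr (by norm_num))
    simpa using h2
  have hε2 : 0 < ε ^ 2 := ENNReal.pow_pos hε 2
  obtain ⟨R, hRε, hR⟩ := ((hlimR.eventually_lt_const hε2).and (eventually_gt_atTop 0)).exists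
  have hlow := tendsto_setLIntegral_lowKernel (fun k => (hf k).continuous) hs hQ hfQ hbd hweak
    (16 * R) (hZc.prod (isCompact_Icc (a := -R) (b := R)))
  have htot := (tendsto_const_nhds (x := 3 * (ENNReal.ofReal (sliceConst n / R) * (n * 4)))).add
    (ENNReal.Tendsto.const_mul (a := 2) hlow (.inr (by norm_num)))
  rw [mul_zero, add_zero] at htot
  have hev := htot.eventually_lt_const hRε
  rw [prod_atTop_atTop_eq] at hev
  obtain ⟨⟨N₁, N₂⟩, hN⟩ := eventually_atTop.1 hev
  refine ⟨max N₁ N₂, fun k hk m hm => ?_⟩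
  have hlt := hN (k, m) ⟨(le_max_left _ _).trans hk, (le_max_right _ _).trans hm⟩
  have hvL : ⇑(fL k - fL m) =ᵐ[volume] fun p => f k p - f m p := by
    filter_upwards [Lp.coeFn_sub (fL k) (fL m), hfL k, hfL m] with p e1 e2 e3
    rw [e1, Pi.sub_apply, e2, e3]
  have hmain := enorm_sub_projection_sq_le hSmem hSorth ((hf k).sub (hf m)) ((hs k).sub (hs m))
    hvL hZc.isClosed.measurableSet (fun z t hz => by
      have : (z, t) ∉ Q := fun h => hz ⟨_, h, rfl⟩
      rw [hfQ k _ this, hfQ m _ this, sub_zero]) hR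
  have hE : lbarEnergy (fun p => f k p - f m p) ≤ 4 := by
    refine (lbarEnergy_sub_le (hf1 k) (hf1 m)).trans ?_
    calc 2 * (lbarEnergy (f k) + lbarEnergy (f m)) ≤ 2 * (1 + 1) := by
          gcongr
          · exact hen k
          · exact hen m
      _ = 4 := by norm_num
  have e : fL k - S (fL k) - (fL m - S (fL m)) = fL k - fL m - S (fL k - fL m) := by
    rw [map_sub]
    abel
  rw [edist_eq_enorm_sub, e]
  have hsq : ‖fL k - fL m - S (fL k - fL m)‖ₑ ^ 2 < ε ^ 2 := by
    refine hmain.trans_lt (lt_of_le_of_lt ?_ hlt)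
    gcongr
  exact lt_of_not_ge fun h => hsq.not_ge (pow_le_pow_left' h 2)

end Projection

theorem exists_tendsto_eLpNorm_sub_restrict {n : ℕ} (B : Set (Hgrp n))
    {u : ℕ → Lp ℂ 2 (volume : Measure (Hgrp n))} (hu : CauchySeq u) :
    ∃ g : Lp ℂ 2 (volume.restrict B),
      Tendsto (fun m => eLpNorm ((⇑(u m) : Hgrp n → ℂ) - ⇑g) 2 (volume.restrict B))
        atTop (𝓝 0) := by
  obtain ⟨a, ha⟩ := cauchySeq_tendsto_of_complete hu
  have haB : MemLp a 2 (volume.restrict B) := (Lp.memLp a).restrict B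
  refine ⟨haB.toLp, ?_⟩
  have h : Tendsto (fun m => ‖u m - a‖ₑ) atTop (𝓝 0) := by
    simpa using (ha.sub_const a).enorm
  refine tendsto_of_tendsto_of_tendsto_of_le_of_le tendsto_const_nhds h
    (fun _ => zero_le) fun m => ?_
  change eLpNorm _ 2 _ ≤ _
  rw [Lp.enorm_def, ← eLpNorm_congr_ae (Lp.coeFn_sub (u m) a).symm,
    eLpNorm_congr_ae ((EventuallyEq.refl _ ⇑(u m)).sub haB.coeFn_toLp)]
  exact eLpNorm_mono_measure _ Measure.restrict_le_self

theorem exists_subseq_cauchySeq_sub_projection {n : ℕ}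
    {S : Lp ℂ 2 (volume : Measure (Hgrp n)) →L[ℂ] Lp ℂ 2 (volume : Measure (Hgrp n))}
    (hSmem : ∀ f, IsCRfun (⇑(S f)))
    (hSorth : ∀ (f g : Lp ℂ 2 (volume : Measure (Hgrp n))), IsCRfun (⇑g) →
      inner (𝕜 := ℂ) (f - S f) g = 0)
    {f : ℕ → Hgrp n → ℂ} (hf : ∀ k, ContDiff ℝ ∞ (f k)) (hs : ∀ k, HasCompactSupport (f k))
    {Q : Set (Hgrp n)} (hQ : IsCompact Q) (hfQ : ∀ k, ∀ p ∉ Q, f k p = 0)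
    {fL : ℕ → Lp ℂ 2 (volume : Measure (Hgrp n))} (hfL : ∀ k, ⇑(fL k) =ᵐ[volume] f k)
    (henergy : ∀ k,
      (∫ p : Hgrp n, ‖f k p‖ ^ 2) + ∑ j, ∫ p : Hgrp n, ‖Lbar j (f k) p‖ ^ 2 ≤ 1) :
    ∃ φ : ℕ → ℕ, StrictMono φ ∧ CauchySeq fun k => fL (φ k) - S (fL (φ k)) := by
  rcases Nat.eq_zero_or_pos n with rfl | hn
  · refine ⟨id, strictMono_id, ?_⟩
    have h : ∀ v, v - S v = 0 := fun v =>
      inner_self_eq_zero.1 (hSorth v (v - S v) fun j => j.elim0)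
    simp only [h]
    exact cauchySeq_const 0
  · have : NeZero n := ⟨hn.ne'⟩
    have h0 : ∀ k, 0 ≤ ∫ p : Hgrp n, ‖f k p‖ ^ 2 := fun k =>
      integral_nonneg fun p => by positivity
    have h1 : ∀ k, 0 ≤ ∑ j, ∫ p : Hgrp n, ‖Lbar j (f k) p‖ ^ 2 := fun k =>
      Finset.sum_nonneg fun j _ => integral_nonneg fun p => by positivity
    have hbd : ∀ k, ∫ p, ‖f k p‖ ^ 2 ≤ 1 := fun k => by linarith [henergy k, h1 k]
    have hen : ∀ k, lbarEnergy (f k) ≤ 1 := fun k => by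
      rw [lbarEnergy_eq_ofReal ((hf k).of_le (by norm_cast)) (hs k)]
      exact ENNReal.ofReal_le_one.2 (by linarith [henergy k, h0 k])
    have hnorm : ∀ k, ‖fL k‖ ≤ 1 := by
      intro k
      have h : ‖fL k‖ₑ ^ 2 ≤ 1 := by
        rw [Lp.enorm_def, eLpNorm_congr_ae (hfL k), eLpNorm_two_sq,
          lintegral_enorm_sq_eq_ofReal (hf k).continuous (hs k)]
        exact ENNReal.ofReal_le_one.2 (hbd k)
      rw [← ofReal_norm, ← ENNReal.ofReal_pow (norm_nonneg _), ENNReal.ofReal_le_one] at h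
      exact (sq_le_one_iff₀ (norm_nonneg _)).1 h
    obtain ⟨φ, hφ, hweak⟩ := exists_subseq_tendsto_integral hfL hnorm
    exact ⟨φ, hφ, cauchySeq_sub_projection hSmem hSorth (fun k => hf (φ k)) (fun k => hs (φ k))
      hQ (fun k => hfQ (φ k)) (fun k => hfL (φ k)) (fun k => hbd (φ k)) (fun k => hen (φ k))
      hweak⟩

/-- (ℍⁿ,σ) satisfies property C at every point: for every bounded open
B ⊂ ℂⁿ×ℝ and every sequence fₖ ∈ C_c^∞(B) with CR energy ≤ 1, some subsequence of
(1 − Sₙ)fₖ converges in L²(B,σ). Here S is the orthogonal projection onto CR²(ℍⁿ,σ). -/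
theorem heisenberg_property_C (n : ℕ)
    (S : Lp ℂ 2 (volume : Measure (Hgrp n)) →L[ℂ] Lp ℂ 2 (volume : Measure (Hgrp n)))
    (hSmem : ∀ f, IsCRfun (⇑(S f)))
    (hSorth : ∀ (f g : Lp ℂ 2 (volume : Measure (Hgrp n))), IsCRfun (⇑g) →
      inner (𝕜 := ℂ) (f - S f) g = 0)
    (B : Set (Hgrp n)) (hBopen : IsOpen B) (hBbdd : Bornology.IsBounded B)
    (f : ℕ → Hgrp n → ℂ)
    (hsmooth : ∀ k, ContDiff ℝ ∞ (f k))
    (hsupp : ∀ k, HasCompactSupport (f k))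
    (hsuppB : ∀ k, tsupport (f k) ⊆ B)
    (fL : ℕ → Lp ℂ 2 (volume : Measure (Hgrp n)))
    (hfL : ∀ k, (⇑(fL k) : Hgrp n → ℂ) =ᵐ[volume] f k)
    (henergy : ∀ k,
      (∫ p : Hgrp n, ‖f k p‖ ^ 2) + ∑ j, ∫ p : Hgrp n, ‖Lbar j (f k) p‖ ^ 2 ≤ 1) :
    ∃ φ : ℕ → ℕ, StrictMono φ ∧
      ∃ g : Lp ℂ 2 (volume.restrict B),
        Tendsto
          (fun m => eLpNorm
            ((⇑(fL (φ m) - S (fL (φ m))) : Hgrp n → ℂ) - (⇑g : Hgrp n → ℂ))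
            2 (volume.restrict B))
          atTop (𝓝 0) := by
  obtain ⟨φ, hφ, hc⟩ := exists_subseq_cauchySeq_sub_projection hSmem hSorth hsmooth hsupp
    hBbdd.isCompact_closure
    (fun k p hp => image_eq_zero_of_notMem_tsupport fun h => hp (subset_closure (hsuppB k h)))
    hfL henergy
  exact ⟨φ, hφ, exists_tendsto_eLpNorm_sub_restrict B hc⟩
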